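/- Let L be a finitely generated S-module. Then for almost all α: (i) Ann_{S_α}(L_α) = (Ann_S L)_α, i.e. the annihilator of the specialization equals the specialization of the annihilator; and (ii) dim L_α = dim L (Krull dimensions over S_α and S respectively). -/

import Mathlib

set_option maxHeartbeats 1000000
set_option synthInstance.maxHeartbeats 1000000

noncomputable section

namespace Spl

open MvPolynomial

/-- "Q(α) holds for almost all α ∈ K^m", i.e. away from a proper algebraic
subvariety of `K^m`. -/
def AlmostAll (K : Type) [Field K] (m : ℕ) (Q : (Fin m → K) → Prop) : Prop :=
  ∃ c : MvPolynomial (Fin m) K, c ≠ 0 ∧ ∀ α : Fin m → K, MvPolynomial.eval α c ≠ 0 → Q α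

variable (k K : Type) [Field k] [Field K] [Algebra k K]

/-- the field k(u) of rational functions in u = (u_1, ..., u_m) -/
abbrev kU (m : ℕ) := FractionRing (MvPolynomial (Fin m) k)

/-- the polynomial ring R = k(u)[X_1, ..., X_n] -/
abbrev Rg (m n : ℕ) := MvPolynomial (Fin n) (kU k m)

/-- the subfield k(α) ⊆ K generated by α = (α_1, ..., α_m) over k -/
abbrev kA {m : ℕ} (α : Fin m → K) := IntermediateField.adjoin k (Set.range α)

/-- the polynomial ring R_α = k(α)[X_1, ..., X_n] -/
abbrev Ra {m : ℕ} (n : ℕ) (α : Fin m → K) := MvPolynomial (Fin n) (kA k K α)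

/-- evaluation u ↦ α, from k[u] to k(α) -/
def evalα {m : ℕ} (α : Fin m → K) : MvPolynomial (Fin m) k →+* kA k K α :=
  (MvPolynomial.aeval fun i =>
    (⟨α i, IntermediateField.subset_adjoin k (Set.range α) ⟨i, rfl⟩⟩ : kA k K α)).toRingHom

/-- the inclusion k[u][X] → R = k(u)[X] -/
def toR (m n : ℕ) : MvPolynomial (Fin n) (MvPolynomial (Fin m) k) →+* Rg k m n :=
  MvPolynomial.map (algebraMap (MvPolynomial (Fin m) k) (kU k m))

/-- substitution u ↦ α, from k[u][X] to R_α = k(α)[X] -/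
def toRa {m : ℕ} (n : ℕ) (α : Fin m → K) :
    MvPolynomial (Fin n) (MvPolynomial (Fin m) k) →+* Ra k K n α :=
  MvPolynomial.map (evalα k K α)

/-- Krull's specialization I_α = { f(α,X) | f(u,X) ∈ I ∩ k[u,X] } of an ideal I ⊆ R
(as an ideal of R_α, i.e. the ideal spanned by the specialized elements). -/
def idealSpec {m : ℕ} (n : ℕ) (α : Fin m → K) (I : Ideal (Rg k m n)) :
    Ideal (Ra k K n α) :=
  Ideal.span (toRa k K n α '' { f | toR k m n f ∈ I })

/-- `ElemSpec k K n α f fα` : fα is the specialization of f ∈ R at α, i.e. writing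
f = p(u,X)/q(u) with q(α) ≠ 0 one has fα = p(α,X)/q(α). -/
def ElemSpec {m : ℕ} (n : ℕ) (α : Fin m → K) (f : Rg k m n) (fα : Ra k K n α) : Prop :=
  ∃ (p : MvPolynomial (Fin n) (MvPolynomial (Fin m) k)) (q : MvPolynomial (Fin m) k),
    evalα k K α q ≠ 0 ∧
    MvPolynomial.C (algebraMap (MvPolynomial (Fin m) k) (kU k m) q) * f = toR k m n p ∧
    MvPolynomial.C (evalα k K α q) * fα = toRa k K n α p

variable {k K}

/-- `LocElemSpec P ℘ a aα` : aα ∈ S_α = (R_α)_℘ is the specialization of a ∈ S = R_P,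
i.e. writing a = f/g with f, g ∈ R, g ∉ P, one has g_α ∉ ℘ and aα = f_α/g_α. -/
def LocElemSpec {m n : ℕ} {α : Fin m → K} (P : Ideal (Rg k m n)) [P.IsPrime]
    (℘ : Ideal (Ra k K n α)) [℘.IsPrime]
    {S : Type} [CommRing S] [Algebra (Rg k m n) S] [IsLocalization.AtPrime S P]
    {Sα : Type} [CommRing Sα] [Algebra (Ra k K n α) Sα] [IsLocalization.AtPrime Sα ℘]
    (a : S) (aα : Sα) : Prop :=
  ∃ (f g : Rg k m n) (fα gα : Ra k K n α) (hg : g ∈ P.primeCompl)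
    (hgα : gα ∈ ℘.primeCompl),
    ElemSpec k K n α f fα ∧ ElemSpec k K n α g gα ∧
    a = IsLocalization.mk' S f ⟨g, hg⟩ ∧
    aα = IsLocalization.mk' Sα fα ⟨gα, hgα⟩

/-- entrywise specialization of matrices, relative to an element-specialization
relation `E`. -/
def MatSpec {S T : Type} (E : S → T → Prop) {r s : ℕ}
    (A : Matrix (Fin r) (Fin s) S) (B : Matrix (Fin r) (Fin s) T) : Prop :=
  ∀ i j, E (A i j) (B i j)

/-- the cokernel of the linear map attached to a matrix A, i.e. the module
presented by A. -/
abbrev MatCoker {S : Type} [CommRing S] {r s : ℕ} (A : Matrix (Fin r) (Fin s) S) :=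
  (Fin r → S) ⧸ LinearMap.range A.mulVecLin

/-- a finite free presentation F_1 → F_0 → L → 0 of the module L, where the map
F_1 → F_0 is given by the matrix A and the map F_0 → L is π. -/
structure Present (S : Type) [CommRing S] (r s : ℕ) (L : Type) [AddCommGroup L]
    [Module S L] where
  A : Matrix (Fin r) (Fin s) S
  π : (Fin r → S) →ₗ[S] L
  surj : Function.Surjective π
  ker_eq : LinearMap.ker π = LinearMap.range A.mulVecLin

theorem comm_le {S : Type} [CommRing S] {r s r' s' : ℕ} {B : Matrix (Fin r) (Fin s) S}
    {C : Matrix (Fin r') (Fin s') S} {W : Matrix (Fin r') (Fin r) S}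
    {W1 : Matrix (Fin s') (Fin s) S} (h : W * B = C * W1) :
    LinearMap.range B.mulVecLin ≤ (LinearMap.range C.mulVecLin).comap W.mulVecLin := by
  rintro x ⟨y, rfl⟩
  exact ⟨W1.mulVecLin y, by
    simp only [Matrix.mulVecLin_apply, Matrix.mulVec_mulVec, h]⟩

/-- the map between the modules presented by B and C induced by the matrix W
(a specialization of a lift of a map between the presented modules). -/
def cokerMap {S : Type} [CommRing S] {r s r' s' : ℕ} {B : Matrix (Fin r) (Fin s) S}
    {C : Matrix (Fin r') (Fin s') S} (W : Matrix (Fin r') (Fin r) S)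
    (h : LinearMap.range B.mulVecLin ≤ (LinearMap.range C.mulVecLin).comap W.mulVecLin) :
    MatCoker B →ₗ[S] MatCoker C :=
  Submodule.mapQ _ _ W.mulVecLin h

/-- a lift of a homomorphism v : L → M to given finite free presentations of L and M:
a commutative diagram whose vertical maps are given by the matrices V1, V0. -/
structure MapLift {S : Type} [CommRing S] {rL sL rM sM : ℕ} {L M : Type}
    [AddCommGroup L] [Module S L] [AddCommGroup M] [Module S M]
    (pL : Present S rL sL L) (pM : Present S rM sM M) (v : L →ₗ[S] M) where
  V0 : Matrix (Fin rM) (Fin rL) S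
  V1 : Matrix (Fin sM) (Fin sL) S
  comm0 : pM.π ∘ₗ V0.mulVecLin = v ∘ₗ pL.π
  comm1 : V0 * pL.A = pM.A * V1

/-- Krull dimension of a module, dim L = dim S/Ann L. -/
def moduleDim (S : Type) [CommRing S] (L : Type) [AddCommGroup L] [Module S L] :
    WithBot ℕ∞ :=
  ringKrullDim (S ⧸ Module.annihilator S L)

/-- height of an ideal: the infimum of dim S_p over the primes p ⊇ I. -/
def idealHeight {S : Type} [CommRing S] (I : Ideal S) : WithBot ℕ∞ :=
  sInf { d | ∃ (p : Ideal S) (hp : p.IsPrime), I ≤ p ∧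
    d = ringKrullDim (Localization (@Ideal.primeCompl _ _ p hp)) }

/-- length of a module: the longest chain of submodules. -/
def moduleLength (S : Type) [CommRing S] (L : Type) [AddCommGroup L] [Module S L] :
    WithBot ℕ∞ :=
  Order.krullDim (Submodule S L)

/-- grade(𝔞, L) ≥ t : there is an L-regular sequence of length t in 𝔞. -/
def GradeGE {S : Type} [CommRing S] (𝔞 : Ideal S) (L : Type) [AddCommGroup L]
    [Module S L] (t : ℕ) : Prop :=
  ∃ rs : List S, rs.length = t ∧ (∀ x ∈ rs, x ∈ 𝔞) ∧ RingTheory.Sequence.IsRegular L rs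

/-- grade(𝔞, L) : the length of a maximal L-regular sequence in 𝔞. -/
def grade {S : Type} [CommRing S] (𝔞 : Ideal S) (L : Type) [AddCommGroup L]
    [Module S L] : ℕ∞ :=
  sSup { t : ℕ∞ | ∃ t' : ℕ, t = (t' : ℕ∞) ∧ GradeGE 𝔞 L t' }

/-- depth of a module over a local ring: grade(𝔪, L). -/
def depth (S : Type) [CommRing S] [IsLocalRing S] (L : Type) [AddCommGroup L]
    [Module S L] : ℕ∞ :=
  grade (IsLocalRing.maximalIdeal S) L

/-- proj dim L ≤ d : L admits a finite free resolution of length ≤ d, encoded as a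
(possibly infinite) free resolution ⋯ → F_1 → F_0 → L → 0 with F_j = 0 for j > d. -/
def ProjDimLE (S : Type) [CommRing S] (L : Type) [AddCommGroup L] [Module S L]
    (d : ℕ) : Prop :=
  ∃ (r : ℕ → ℕ) (A : ∀ j : ℕ, Matrix (Fin (r j)) (Fin (r (j + 1))) S)
    (π : (Fin (r 0) → S) →ₗ[S] L),
    Function.Surjective π ∧ LinearMap.ker π = LinearMap.range (A 0).mulVecLin ∧
    (∀ j : ℕ, LinearMap.ker (A j).mulVecLin = LinearMap.range (A (j + 1)).mulVecLin) ∧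
    ∀ j : ℕ, d < j → r j = 0

/-- projective dimension of a module, as an extended natural number. -/
def projDim (S : Type) [CommRing S] (L : Type) [AddCommGroup L] [Module S L] : ℕ∞ :=
  sInf { d : ℕ∞ | ∃ d' : ℕ, d = (d' : ℕ∞) ∧ ProjDimLE S L d' }

/-- the i-th local cohomology module H^i_𝔞(L) as a module. -/
abbrev localCoh {S : Type} [CommRing S] (𝔞 : Ideal S) (i : ℕ) (L : Type)
    [AddCommGroup L] [Module S L] : ModuleCat S :=
  (localCohomology 𝔞 i).obj (ModuleCat.of S L)

/-- the colon submodule (0 :_L 𝔞) = { x ∈ L | 𝔞 x = 0 }. -/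
def colonSubmodule {S : Type} [CommRing S] (𝔞 : Ideal S) (L : Type) [AddCommGroup L]
    [Module S L] : Submodule S L where
  carrier := { x | ∀ c ∈ 𝔞, c • x = 0 }
  add_mem' := by
    intro a b ha hb c hc
    rw [smul_add, ha c hc, hb c hc, add_zero]
  zero_mem' := by
    intro c _
    rw [smul_zero]
  smul_mem' := by
    intro s x hx c hc
    rw [smul_comm, hx c hc, smul_zero]

/-- a (partial) system of parameters: the d = dim L elements a_1, ..., a_d lie in the
maximal ideal and L/(a_1, ..., a_d)L has dimension ≤ 0. -/
def IsSOP (S : Type) [CommRing S] [IsLocalRing S] (L : Type) [AddCommGroup L]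
    [Module S L] {d : ℕ} (a : Fin d → S) : Prop :=
  (∀ i, a i ∈ IsLocalRing.maximalIdeal S) ∧
  moduleDim S L = (d : ℕ∞) ∧
  moduleDim S (L ⧸ (Ideal.span (Set.range a) • (⊤ : Submodule S L))) ≤ 0

/-- a standard system of parameters: (a_1, ..., a_d) H^i_𝔪(L/(a_1, ..., a_j)L) = 0
for all i + j < d. -/
def IsStandardSOP (S : Type) [CommRing S] [IsLocalRing S] (L : Type) [AddCommGroup L]
    [Module S L] {d : ℕ} (a : Fin d → S) : Prop :=
  IsSOP S L a ∧
  ∀ i j : ℕ, i + j < d →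
    Ideal.span (Set.range a) ≤ Module.annihilator S
      (localCoh (IsLocalRing.maximalIdeal S) i
        (L ⧸ (Ideal.span (a '' { x : Fin d | (x : ℕ) < j }) • (⊤ : Submodule S L))))

/-- a standard ideal for L: an 𝔪-primary ideal 𝔞 such that every system of
parameters of L contained in 𝔞 is standard. -/
def IsStandardIdeal (S : Type) [CommRing S] [IsLocalRing S] (L : Type) [AddCommGroup L]
    [Module S L] (𝔞 : Ideal S) : Prop :=
  𝔞.radical = IsLocalRing.maximalIdeal S ∧
  ∀ (d : ℕ) (a : Fin d → S), (∀ i, a i ∈ 𝔞) → IsSOP S L a → IsStandardSOP S L a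

theorem exists_finite_dominating_of_wellQuasiOrdered {β : Type*} [PartialOrder β]
    [WellQuasiOrderedLE β] (D : Set β) :
    ∃ G : Set β, G.Finite ∧ G ⊆ D ∧ ∀ x ∈ D, ∃ g ∈ G, g ≤ x := by
  refine ⟨{x | Minimal (· ∈ D) x}, ?_, fun x hx => hx.1, fun x hx => ?_⟩
  · exact WellQuasiOrderedLE.finite_of_isAntichain (setOfPred_minimal_antichain _)
  · obtain ⟨m, hm, hmin⟩ := exists_minimal_le_of_wellFoundedLT (· ∈ D) x hx
    exact ⟨m, hmin, hm⟩

theorem exists_pow_mul_eq_map {A σ : Type*} [CommRing A] (c : A)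
    (x : MvPolynomial σ (Localization.Away c)) :
    ∃ (N : ℕ) (y : MvPolynomial σ A),
      map (algebraMap A (Localization.Away c)) (C (c ^ N)) * x
        = map (algebraMap A (Localization.Away c)) y := by
  let _ := MvPolynomial.algebraMvPolynomial (σ := σ) (R := A) (S := Localization.Away c)
  have := MvPolynomial.isLocalization (σ := σ) (Submonoid.powers c) (Localization.Away c)
  obtain ⟨⟨y, ⟨_, s, ⟨N, rfl⟩, rfl⟩⟩, h⟩ :=
    IsLocalization.surj ((Submonoid.powers c).map (C (σ := σ))) x
  exact ⟨N, y, by rw [mul_comm]; exact h⟩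

theorem exists_pow_mul_mem_map {A σ : Type*} [CommRing A] (c : A) (I : Ideal (MvPolynomial σ A))
    {x : MvPolynomial σ (Localization.Away c)}
    (hx : x ∈ I.map (map (algebraMap A (Localization.Away c)))) :
    ∃ (N : ℕ), ∃ y ∈ I,
      map (algebraMap A (Localization.Away c)) (C (c ^ N)) * x
        = map (algebraMap A (Localization.Away c)) y := by
  let _ := MvPolynomial.algebraMvPolynomial (σ := σ) (R := A) (S := Localization.Away c)
  have := MvPolynomial.isLocalization (σ := σ) (Submonoid.powers c) (Localization.Away c)
  obtain ⟨⟨y, ⟨_, s, ⟨N, rfl⟩, rfl⟩⟩, h⟩ :=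
    (IsLocalization.mem_map_algebraMap_iff ((Submonoid.powers c).map (C (σ := σ)))
      (MvPolynomial σ (Localization.Away c))).1 hx
  exact ⟨N, y, y.2, by rw [mul_comm]; exact h⟩

/-- Division with remainder by an ideal after inverting one element of the coefficient domain:
the remainder is a linear projection along the extended ideal. -/
theorem exists_normalForm {A σ : Type*} [CommRing A] [IsDomain A] [Finite σ]
    (I : Ideal (MvPolynomial σ A)) :
    ∃ c : A, c ≠ 0 ∧
      ∃ θ : MvPolynomial σ (Localization.Away c) →ₗ[Localization.Away c]
          MvPolynomial σ (Localization.Away c),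
        (∀ x ∈ I.map (map (algebraMap A (Localization.Away c))), θ x = 0) ∧
        ∀ x, x - θ x ∈ I.map (map (algebraMap A (Localization.Away c))) := by
  classical
  obtain ⟨N, ⟨eσ⟩⟩ := Finite.exists_equiv_fin σ
  let : LinearOrder σ := LinearOrder.lift' eσ eσ.injective
  let m : MonomialOrder σ := MonomialOrder.lex
  obtain ⟨G, hGfin, hGD, hG⟩ := exists_finite_dominating_of_wellQuasiOrdered
    {d : σ →₀ ℕ | ∃ f ∈ I, f ≠ 0 ∧ m.degree f = d}
  have hGD' : ∀ d, d ∈ G → ∃ f ∈ I, f ≠ 0 ∧ m.degree f = d := fun d hd => hGD hd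
  choose! b hbI hb0 hbd using hGD'
  have hc0 : ∏ d ∈ hGfin.toFinset, m.leadingCoeff (b d) ≠ 0 := by
    rw [Finset.prod_ne_zero_iff]
    intro d hd
    exact m.leadingCoeff_ne_zero_iff.2 (hb0 d (hGfin.mem_toFinset.1 hd))
  set c := ∏ d ∈ hGfin.toFinset, m.leadingCoeff (b d) with hc
  refine ⟨c, hc0, ?_⟩
  set L := Localization.Away c
  have hinj : Function.Injective (algebraMap A L) :=
    IsLocalization.injective L (powers_le_nonZeroDivisors_of_noZeroDivisors hc0)
  have : IsDomain L :=
    IsLocalization.isDomain_localization (powers_le_nonZeroDivisors_of_noZeroDivisors hc0)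
  set φ := map (σ := σ) (algebraMap A L) with hφ
  have hφinj : Function.Injective φ := map_injective _ hinj
  have hsupp : ∀ f : MvPolynomial σ A, (φ f).support = f.support := fun f =>
    support_map_of_injective f hinj
  have hdeg : ∀ f, m.degree (φ f) = m.degree f := fun f => by
    simp only [MonomialOrder.degree, hsupp]
  have hlc : ∀ d ∈ G, IsUnit (m.leadingCoeff (φ (b d))) := by
    intro d hd
    rw [MonomialOrder.leadingCoeff, hdeg, coeff_map]
    refine isUnit_of_dvd_unit (map_dvd (algebraMap A L)
      (Finset.dvd_prod_of_mem (fun d => m.leadingCoeff (b d)) (hGfin.mem_toFinset.2 hd)))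
      (IsLocalization.Away.algebraMap_isUnit c)
  let V : Submodule L (MvPolynomial σ L) := restrictSupport L {d | ∀ g ∈ G, ¬ g ≤ d}
  let U : Submodule L (MvPolynomial σ L) := (I.map φ).restrictScalars L
  have hUV : IsCompl U V := by
    rw [isCompl_iff, Submodule.disjoint_def, codisjoint_iff]
    constructor
    · intro x hxU hxV
      by_contra hx
      obtain ⟨N, y, hy, hxy⟩ := exists_pow_mul_mem_map c I (x := x) hxU
      have hu : algebraMap A L (c ^ N) ≠ 0 := by
        rw [Ne, map_eq_zero_iff _ hinj]; exact pow_ne_zero _ hc0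
      rw [map_C] at hxy
      have hy0 : y ≠ 0 := by
        rintro rfl
        rw [map_zero] at hxy
        rcases mul_eq_zero.1 hxy with h | h
        · exact hu (by simpa using h)
        · exact hx h
      have hs : y.support = x.support := by
        have hxy' : φ y = C (algebraMap A L (c ^ N)) * x := hxy.symm
        rw [← hsupp, hxy']
        ext d
        rw [mem_support_iff, mem_support_iff, coeff_C_mul, mul_ne_zero_iff, and_iff_right hu]
      obtain ⟨g, hg, hle⟩ := hG (m.degree y) ⟨y, hy, hy0, rfl⟩
      have hd : m.degree y ∈ x.support := hs ▸ m.degree_mem_support hy0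
      exact hxV hd g hg hle
    · rw [eq_top_iff]
      intro x _
      obtain ⟨q, r, hx, -, hr⟩ := m.div (b := fun g : G => φ (b g)) (fun g => hlc g g.2) x
      rw [hx]
      refine Submodule.add_mem_sup ?_ ?_
      · change _ ∈ I.map φ
        rw [Finsupp.linearCombination_apply]
        exact Ideal.sum_mem _ fun g _ => Ideal.mul_mem_left _ _
          (Ideal.mem_map_of_mem _ (hbI g g.2))
      · intro d hd g hg
        have := hr d hd ⟨g, hg⟩
        rwa [hdeg, hbd g hg] at this
  have hker : ∀ x, V.projection U hUV.symm x = 0 ↔ x ∈ U := fun x => by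
    rw [← Submodule.coe_projectionOnto_apply, ZeroMemClass.coe_eq_zero,
      Submodule.projectionOnto_apply_eq_zero_iff]
  refine ⟨V.projection U hUV.symm, fun x hx => (hker x).2 hx, fun x => (hker _).1 ?_⟩
  rw [map_sub, sub_eq_zero]
  exact (DFunLike.congr_fun (Submodule.isIdempotentElem_projection hUV.symm) x).symm

/-- A linear map over the coefficients can be base-changed along a ring homomorphism. -/
theorem exists_linearMap_map {L F σ τ : Type*} [CommRing L] [CommRing F] (ρ : L →+* F)
    (θ : MvPolynomial σ L →ₗ[L] MvPolynomial τ L) :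
    ∃ θ' : MvPolynomial σ F →ₗ[F] MvPolynomial τ F, ∀ x, θ' (map ρ x) = map ρ (θ x) := by
  refine ⟨(basisMonomials σ F).constr F fun s => map ρ (θ (monomial s 1)), fun x => ?_⟩
  have hm : ∀ (s : σ →₀ ℕ) (a : L), (basisMonomials σ F).constr F
      (fun s => map ρ (θ (monomial s 1))) (map ρ (monomial s a)) = map ρ (θ (monomial s a)) := by
    intro s a
    have h : monomial s a = a • monomial s (1 : L) := by rw [smul_monomial, smul_eq_mul, mul_one]
    have h' : monomial s (ρ a) = ρ a • basisMonomials σ F s := by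
      rw [coe_basisMonomials, smul_monomial, smul_eq_mul, mul_one]
    rw [map_monomial, h', h, map_smul, map_smul, Module.Basis.constr_basis, smul_eq_C_mul,
      smul_eq_C_mul, map_mul, map_C]
  rw [x.as_sum]
  simp only [map_sum, hm]

theorem induction_of_map {L F σ : Type*} [CommRing L] [CommRing F] (ρ : L →+* F)
    {p : MvPolynomial σ F → Prop} (h0 : p 0) (hadd : ∀ x y, p x → p y → p (x + y))
    (hmap : ∀ (a : F) (x : MvPolynomial σ L), p (a • map ρ x)) (x : MvPolynomial σ F) : p x := by
  have hm : ∀ s a, p (monomial s a) := fun s a => by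
    have := hmap a (monomial s 1)
    rwa [map_monomial, map_one, smul_monomial, smul_eq_mul, mul_one] at this
  rw [x.as_sum]
  exact Finset.sum_induction _ p hadd h0 fun s _ => hm s _

theorem induction_mem_map {L F σ : Type*} [CommRing L] [CommRing F] (ρ : L →+* F)
    (I : Ideal (MvPolynomial σ L))
    {p : MvPolynomial σ F → Prop} (h0 : p 0) (hadd : ∀ x y, p x → p y → p (x + y))
    (hmap : ∀ (a : F), ∀ x ∈ I, p (a • map ρ x)) {x : MvPolynomial σ F}
    (hx : x ∈ I.map (map ρ)) : p x := by
  have key : ∀ y, p (y * x) := by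
    refine Submodule.span_induction (p := fun x _ => ∀ y, p (y * x)) ?_ ?_ ?_ ?_ hx
    · rintro _ ⟨x, hx, rfl⟩ y
      induction y using induction_of_map ρ with
      | h0 => rwa [zero_mul]
      | hadd y z hy hz => rw [add_mul]; exact hadd _ _ hy hz
      | hmap a y => rw [smul_mul_assoc, ← map_mul]; exact hmap a _ (I.mul_mem_left _ hx)
    · intro y; rwa [mul_zero]
    · intro x z _ _ hx hz y; rw [mul_add]; exact hadd _ _ (hx y) (hz y)
    · intro a x _ hx y; rw [smul_eq_mul, ← mul_assoc]; exact hx _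
  simpa using key 1

theorem normalForm_map {L F σ : Type*} [CommRing L] [CommRing F] (ρ : L →+* F)
    (I : Ideal (MvPolynomial σ L)) (θ : MvPolynomial σ L →ₗ[L] MvPolynomial σ L)
    (h1 : ∀ x ∈ I, θ x = 0) (h2 : ∀ x, x - θ x ∈ I) :
    ∃ θ' : MvPolynomial σ F →ₗ[F] MvPolynomial σ F,
      (∀ x ∈ I.map (map ρ), θ' x = 0) ∧ ∀ x, x - θ' x ∈ I.map (map ρ) := by
  obtain ⟨θ', hθ'⟩ := exists_linearMap_map ρ θ
  refine ⟨θ', fun x hx => ?_, fun x => ?_⟩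
  · refine induction_mem_map ρ I (p := fun x => θ' x = 0) (map_zero _) ?_ ?_ hx
    · intro x y hx hy
      rw [map_add, hx, hy, add_zero]
    · intro a x hx
      rw [map_smul, hθ', h1 x hx, map_zero, smul_zero]
  · induction x using induction_of_map ρ with
    | h0 => simp
    | hadd x y hx hy => rw [map_add, add_sub_add_comm]; exact add_mem hx hy
    | hmap a x =>
      rw [map_smul, hθ', ← smul_sub, ← map_sub, smul_eq_C_mul]
      exact Ideal.mul_mem_left _ _ (Ideal.mem_map_of_mem _ (h2 x))

theorem map_awayLift {A F σ : Type*} [CommRing A] [CommRing F] (ρ : A →+* F) {c : A}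
    (hc : IsUnit (ρ c)) (x : MvPolynomial σ A) :
    map (IsLocalization.Away.lift (S := Localization.Away c) c hc)
      (map (algebraMap A (Localization.Away c)) x) = map ρ x := by
  rw [map_map, IsLocalization.Away.lift_comp]

theorem ideal_map_awayLift {A F σ : Type*} [CommRing A] [CommRing F] (ρ : A →+* F) {c : A}
    (hc : IsUnit (ρ c)) (I : Ideal (MvPolynomial σ A)) :
    (I.map (map (algebraMap A (Localization.Away c)))).map
      (map (IsLocalization.Away.lift (S := Localization.Away c) c hc)) = I.map (map ρ) := by
  rw [Ideal.map_map]
  congr 1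
  exact RingHom.ext fun x => map_awayLift ρ hc x

theorem exists_normalForm_map {A σ : Type*} [CommRing A] [IsDomain A] [Finite σ]
    (I : Ideal (MvPolynomial σ A)) :
    ∃ c : A, c ≠ 0 ∧ ∀ (F : Type) [CommRing F] (ρ : A →+* F), IsUnit (ρ c) →
      ∃ θ : MvPolynomial σ F →ₗ[F] MvPolynomial σ F,
        (∀ x ∈ I.map (map ρ), θ x = 0) ∧ ∀ x, x - θ x ∈ I.map (map ρ) := by
  obtain ⟨c, hc, θ, h1, h2⟩ := exists_normalForm I
  refine ⟨c, hc, fun F _ ρ hρ => ?_⟩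
  have := normalForm_map (IsLocalization.Away.lift (S := Localization.Away c) c hρ) _ θ h1 h2
  rwa [ideal_map_awayLift] at this

theorem mem_map_of_mul_mem_map {A σ : Type*} [CommRing A] [IsDomain A] {c : A} (hc : c ≠ 0)
    {I J : Ideal (MvPolynomial σ A)} {f : MvPolynomial σ A} (hJ : ∀ x, x * f ∈ I → x ∈ J)
    {x : MvPolynomial σ (Localization.Away c)}
    (hx : x * map (algebraMap A (Localization.Away c)) f ∈
      I.map (map (algebraMap A (Localization.Away c)))) :
    x ∈ J.map (map (algebraMap A (Localization.Away c))) := by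
  have hinj : Function.Injective (map (σ := σ) (algebraMap A (Localization.Away c))) :=
    map_injective _ (IsLocalization.injective _ (powers_le_nonZeroDivisors_of_noZeroDivisors hc))
  obtain ⟨N, y, hy⟩ := exists_pow_mul_eq_map c x
  obtain ⟨M, z, hz, hzx⟩ := exists_pow_mul_mem_map c I hx
  have h1 : C (c ^ M) * y ∈ J := by
    refine hJ _ ?_
    have : C (c ^ M) * y * f = C (c ^ N) * z := hinj <| by
      rw [map_mul, map_mul, ← hy, map_mul, ← hzx]; ring
    rw [this]
    exact I.mul_mem_left _ hz
  have hu : IsUnit (map (σ := σ) (algebraMap A (Localization.Away c)) (C (c ^ M * c ^ N))) := by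
    rw [map_C]
    refine IsUnit.map C ?_
    rw [← pow_add, map_pow]
    exact (IsLocalization.Away.algebraMap_isUnit c).pow _
  rw [← Ideal.unit_mul_mem_iff_mem _ hu, C_mul, map_mul, mul_assoc, hy, ← map_mul]
  exact Ideal.mem_map_of_mem _ h1

/-- Colon ideals by an element commute with a generic change of coefficients. -/
theorem exists_colon_map {A σ : Type*} [CommRing A] [IsDomain A] [Finite σ]
    {I J : Ideal (MvPolynomial σ A)} {f : MvPolynomial σ A} (hJ : ∀ x, x * f ∈ I → x ∈ J) :
    ∃ c : A, c ≠ 0 ∧ ∀ (F : Type) [CommRing F] (ρ : A →+* F), IsUnit (ρ c) →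
      ∀ x, x * map ρ f ∈ I.map (map ρ) → x ∈ J.map (map ρ) := by
  obtain ⟨c, hc, θ, h1, h2⟩ := exists_normalForm (I ⊔ Ideal.span {f})
  refine ⟨c, hc, fun F _ ρ hρ => ?_⟩
  set L := Localization.Away c
  set φ := map (σ := σ) (algebraMap A L) with hφ
  set IL : Submodule L (MvPolynomial σ L) := (I.map φ).restrictScalars L
  set UL : Submodule L (MvPolynomial σ L) :=
    ((I ⊔ Ideal.span {f}).map φ).restrictScalars L with hUL
  have hle : IL ≤ UL := Ideal.map_mono le_sup_left
  have hfU : ∀ t, t * φ f ∈ UL := fun t => Ideal.mul_mem_left _ _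
    (Ideal.mem_map_of_mem _ (Ideal.mem_sup_right (Ideal.mem_span_singleton_self f)))
  let q : MvPolynomial σ L × IL →ₗ[L] UL :=
    LinearMap.coprod ((LinearMap.mulRight L (φ f)).codRestrict UL hfU)
      (Submodule.inclusion hle)
  have hq : ∀ p, (q p : MvPolynomial σ L) = p.1 * φ f + p.2 := fun p => by
    simp only [q, LinearMap.coprod_apply, Submodule.coe_add]
    rfl
  have hqs : Function.Surjective q := by
    rintro ⟨u, hu⟩
    have hu' : u ∈ (I ⊔ Ideal.span {f}).map φ := hu
    rw [Ideal.map_sup, Ideal.map_span, Set.image_singleton, Submodule.mem_sup] at hu'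
    obtain ⟨i, hi, y, hy, rfl⟩ := hu'
    obtain ⟨t, rfl⟩ := Ideal.mem_span_singleton'.1 hy
    exact ⟨(t, ⟨i, hi⟩), Subtype.ext (by rw [hq, add_comm])⟩
  obtain ⟨g, hg⟩ := Module.projective_lifting_property q
    ((LinearMap.id - θ).codRestrict UL h2) hqs
  have hgu : ∀ u ∈ UL, (g u).1 * φ f + (g u).2 = u := fun u hu => by
    rw [← hq, ← LinearMap.comp_apply, hg]
    exact (congrArg (u - ·) (h1 u hu)).trans (sub_zero u)
  obtain ⟨a, ha⟩ := exists_linearMap_map (IsLocalization.Away.lift (S := L) c hρ)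
    (LinearMap.fst L _ _ ∘ₗ g)
  have ha1 : ∀ t, t - (g (t * φ f)).1 ∈ J.map φ := fun t => by
    refine mem_map_of_mul_mem_map hc hJ ?_
    have : (t - (g (t * φ f)).1) * φ f = (g (t * φ f)).2 := by
      rw [sub_mul, sub_eq_iff_eq_add, add_comm, hgu _ (hfU t)]
    exact this ▸ (g (t * φ f)).2.2
  have ha2 : ∀ i ∈ I.map φ, (g i).1 ∈ J.map φ := fun i hi => by
    refine mem_map_of_mul_mem_map hc hJ ?_
    have : (g i).1 * φ f = i - (g i).2 := eq_sub_of_add_eq (hgu _ (hle hi))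
    exact this ▸ sub_mem hi (g i).2.2
  have hφρ := map_awayLift (σ := σ) ρ hρ
  have hJρ := ideal_map_awayLift ρ hρ J
  have hIρ := ideal_map_awayLift ρ hρ I
  set l := IsLocalization.Away.lift (S := L) c hρ with hl
  have hb1 : ∀ t, t - a (t * map ρ f) ∈ J.map (map ρ) := fun t => by
    induction t using induction_of_map l with
    | h0 => simp
    | hadd x y hx hy => rw [add_mul, map_add, add_sub_add_comm]; exact add_mem hx hy
    | hmap b t =>
      rw [smul_mul_assoc, map_smul, ← smul_sub, ← hφρ, ← map_mul, ha, ← map_sub, ← hJρ,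
        smul_eq_C_mul]
      exact Ideal.mul_mem_left _ _ (Ideal.mem_map_of_mem _ (ha1 t))
  have hb2 : ∀ i ∈ I.map (map ρ), a i ∈ J.map (map ρ) := fun i hi => by
    rw [← hIρ] at hi
    refine induction_mem_map l _ (p := fun i => a i ∈ J.map (map ρ)) ?_ ?_ ?_ hi
    · simp
    · intro x y hx hy
      rw [map_add]; exact add_mem hx hy
    · intro b x hx
      rw [map_smul, ha, ← hJρ, smul_eq_C_mul]
      exact Ideal.mul_mem_left _ _ (Ideal.mem_map_of_mem _ (ha2 x hx))
  intro x hx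
  rw [← sub_add_cancel x (a (x * map ρ f))]
  exact add_mem (hb1 x) (hb2 _ hx)

section

/-- A property of ring homomorphisms from a domain to fields holds generically if it holds as
soon as the homomorphism does not kill a certain nonzero element. -/
def Generically {A : Type*} [CommRing A] (Q : ∀ (F : Type) [Field F], (A →+* F) → Prop) : Prop :=
  ∃ c : A, c ≠ 0 ∧ ∀ (F : Type) [Field F] (ρ : A →+* F), ρ c ≠ 0 → Q F ρ

namespace Generically

variable {A : Type*} [CommRing A] {Q Q' : ∀ (F : Type) [Field F], (A →+* F) → Prop}

theorem mono (h : Generically Q) (hQ : ∀ (F : Type) [Field F] (ρ : A →+* F), Q F ρ → Q' F ρ) :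
    Generically Q' := by
  obtain ⟨c, hc, h⟩ := h
  exact ⟨c, hc, fun F _ ρ hρ => hQ F ρ (h F ρ hρ)⟩

variable [IsDomain A]

theorem and (h : Generically Q) (h' : Generically Q') :
    Generically fun F _ ρ => Q F ρ ∧ Q' F ρ := by
  obtain ⟨c, hc, h⟩ := h
  obtain ⟨d, hd, h'⟩ := h'
  refine ⟨c * d, mul_ne_zero hc hd, fun F _ ρ hρ => ?_⟩
  rw [map_mul, mul_ne_zero_iff] at hρ
  exact ⟨h F ρ hρ.1, h' F ρ hρ.2⟩

theorem forall_finite {ι : Type*} [Finite ι]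
    {Q : ι → ∀ (F : Type) [Field F], (A →+* F) → Prop} (h : ∀ i, Generically (Q i)) :
    Generically fun F _ ρ => ∀ i, Q i F ρ := by
  have := Fintype.ofFinite ι
  choose c hc h using h
  refine ⟨∏ i, c i, Finset.prod_ne_zero_iff.2 fun i _ => hc i, fun F _ ρ hρ i => ?_⟩
  rw [map_prod, Finset.prod_ne_zero_iff] at hρ
  exact h i F ρ (hρ i (Finset.mem_univ i))

end Generically

variable {A σ : Type} [CommRing A] [IsDomain A]

omit [IsDomain A] in
theorem generically_map_ne_zero {p : MvPolynomial σ A} (hp : p ≠ 0) :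
    Generically fun _ _ ρ => map ρ p ≠ 0 := by
  obtain ⟨d, hd⟩ := ne_zero_iff.1 hp
  exact ⟨_, hd, fun F _ ρ hρ => ne_zero_iff.2 ⟨d, by rwa [coeff_map]⟩⟩

variable [Finite σ]

theorem generically_colon_map {I J : Ideal (MvPolynomial σ A)} {f : MvPolynomial σ A}
    (hJ : ∀ x, x * f ∈ I → x ∈ J) :
    Generically fun _ _ ρ => ∀ x, x * map ρ f ∈ I.map (map ρ) → x ∈ J.map (map ρ) := by
  obtain ⟨c, hc, h⟩ := exists_colon_map hJ
  exact ⟨c, hc, fun F _ ρ hρ => h F ρ hρ.isUnit⟩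

theorem generically_annihilator_map {r s : ℕ} (f : Matrix (Fin r) (Fin s) (MvPolynomial σ A))
    {I : Ideal (MvPolynomial σ A)}
    (hI : ∀ x, (∀ i, ∃ v, f.mulVec v = Pi.single i x) → x ∈ I) :
    Generically fun _ _ ρ => ∀ x, (∀ i, ∃ v, (f.map (map ρ)).mulVec v = Pi.single i x) →
      x ∈ I.map (map ρ) := by
  classical
  let M := Fin r → MatCoker f
  let Z : Fin r → Fin r → MvPolynomial (σ ⊕ Fin r × Fin r) A := fun i j => X (Sum.inr (i, j))
  let m : Fin r → Fin r → M := fun i j => Pi.single i (Submodule.Quotient.mk (Pi.single j 1))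
  let Φ : MvPolynomial (σ ⊕ Fin r × Fin r) A →+* TrivSqZeroExt (MvPolynomial σ A) M :=
    eval₂Hom ((TrivSqZeroExt.inlHom _ _).comp C)
      (Sum.elim (fun i => TrivSqZeroExt.inl (X i)) fun p => TrivSqZeroExt.inr (m p.1 p.2))
  let π : ∀ (F : Type) [CommRing F],
    MvPolynomial (σ ⊕ Fin r × Fin r) F →+* MvPolynomial σ F := fun F _ =>
      eval₂Hom C (Sum.elim X 0)
  let e : MvPolynomial (σ ⊕ Fin r × Fin r) A := ∑ i, Z i i
  have hfst : ∀ x, (Φ x).fst = π A x := fun x => by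
    have : (TrivSqZeroExt.fstHom (MvPolynomial σ A) (MvPolynomial σ A) M).toRingHom.comp Φ =
        π A := by
      refine ringHom_ext (fun a => ?_) fun i => ?_
      · simp [Φ, π]
      · rcases i with i | i <;> simp [Φ, π]
    exact DFunLike.congr_fun this x
  have hΦC : ∀ x : MvPolynomial σ A, Φ (rename Sum.inl x) = TrivSqZeroExt.inl x := fun x => by
    have : Φ.comp (rename Sum.inl).toRingHom = TrivSqZeroExt.inlHom (MvPolynomial σ A) M := by
      refine ringHom_ext (fun a => ?_) fun i => ?_
      · simp [Φ]
      · simp [Φ]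
    exact DFunLike.congr_fun this x
  have hΦZ : ∀ i j, Φ (Z i j) = TrivSqZeroExt.inr (m i j) := fun i j => by simp [Φ, Z]
  have hinr : ∀ (y : TrivSqZeroExt (MvPolynomial σ A) M) (w : M),
      y * TrivSqZeroExt.inr w = TrivSqZeroExt.inr (y.fst • w) := fun y w => by
    ext <;> simp
  have hJ : ∀ x, x * e ∈ RingHom.ker Φ → x ∈ I.comap (π A) := fun x hx => by
    have h0 : (π A x) • ∑ i, m i i = 0 := by
      rw [RingHom.mem_ker, map_mul, map_sum] at hx
      simp only [hΦZ] at hx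
      rw [← TrivSqZeroExt.inr_sum, hinr, hfst] at hx
      exact TrivSqZeroExt.inr_injective hx
    refine hI _ fun i => ?_
    have h1 := congrFun h0 i
    rw [Pi.smul_apply, Finset.sum_apply, Finset.sum_eq_single i, Pi.zero_apply] at h1
    · simp only [m, Pi.single_eq_same] at h1
      rw [← Submodule.Quotient.mk_smul, Submodule.Quotient.mk_eq_zero] at h1
      obtain ⟨v, hv⟩ := h1
      refine ⟨v, hv.trans ?_⟩
      rw [← Pi.single_smul, smul_eq_mul, mul_one]
    · intro j _ hj
      exact Pi.single_eq_of_ne hj.symm _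
    · simp
  have hgen : ∀ i k, ∑ j, rename Sum.inl (f j k) * Z i j ∈ RingHom.ker Φ := fun i k => by
    rw [RingHom.mem_ker, map_sum]
    simp only [map_mul, hΦC, hΦZ, hinr, TrivSqZeroExt.fst_inl]
    rw [← TrivSqZeroExt.inr_sum, ← TrivSqZeroExt.inr_zero]
    congr 1
    have hcol : ∑ j, f j k • (Pi.single j 1 : Fin r → MvPolynomial σ A) =
        f.mulVec (Pi.single k 1) := by
      rw [Matrix.mulVec_single_one]
      ext j : 1
      rw [Finset.sum_apply, Finset.sum_eq_single j] <;> simp +contextual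
    let l : (Fin r → MvPolynomial σ A) →ₗ[MvPolynomial σ A] M :=
      LinearMap.single _ _ i ∘ₗ Submodule.mkQ _
    have hl : ∑ j, f j k • m i j = l (∑ j, f j k • Pi.single j 1) := by
      rw [map_sum]
      exact Finset.sum_congr rfl fun j _ => (map_smul l _ _).symm
    have h0 : (Submodule.mkQ (LinearMap.range f.mulVecLin)) (f.mulVec (Pi.single k 1)) = 0 :=
      (Submodule.Quotient.mk_eq_zero _).2 ⟨_, rfl⟩
    rw [hl, hcol, LinearMap.comp_apply, h0, map_zero]
  refine (generically_colon_map hJ).mono fun F _ ρ h x hx => ?_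
  have hπ : ∀ y, π F (map ρ y) = map ρ (π A y) := fun y => by
    have : (π F).comp (map ρ) = (map ρ).comp (π A) := by
      refine ringHom_ext (fun a => ?_) fun i => ?_
      · simp [π]
      · rcases i with i | i <;> simp [π]
    exact DFunLike.congr_fun this y
  have hle : ((I.comap (π A)).map (map ρ)).map (π F) ≤ I.map (map ρ) := by
    rw [Ideal.map_map, Ideal.map_le_iff_le_comap]
    intro y hy
    rw [Ideal.mem_comap, RingHom.comp_apply, hπ]
    exact Ideal.mem_map_of_mem _ hy
  have hx' : π F (rename Sum.inl x) = x := by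
    have : (π F).comp (rename Sum.inl).toRingHom = RingHom.id _ := by
      refine ringHom_ext (fun a => ?_) fun i => ?_ <;> simp [π]
    exact DFunLike.congr_fun this x
  rw [← hx']
  refine hle (Ideal.mem_map_of_mem _ (h _ ?_))
  choose v hv using hx
  have : rename Sum.inl x * map ρ e =
      ∑ i, ∑ k, rename Sum.inl (v i k) * map ρ (∑ j, rename Sum.inl (f j k) * Z i j) := by
    simp only [e, map_sum, Finset.mul_sum, map_mul, map_rename]
    refine Finset.sum_congr rfl fun i _ => ?_
    rw [Finset.sum_comm, Finset.sum_eq_single i]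
    · have h1 := congrArg (rename (R := F) (Sum.inl (β := Fin r × Fin r))) (congrFun (hv i) i)
      rw [Pi.single_eq_same] at h1
      rw [← h1, Matrix.mulVec, dotProduct, map_sum, Finset.sum_mul]
      refine Finset.sum_congr rfl fun k _ => ?_
      rw [map_mul, Matrix.map_apply]; ring
    · intro j _ hj
      have h1 := congrArg (rename (R := F) (Sum.inl (β := Fin r × Fin r))) (congrFun (hv i) j)
      rw [Pi.single_eq_of_ne hj, Matrix.mulVec, dotProduct, map_sum, map_zero] at h1
      rw [← zero_mul (map ρ (Z i j)), ← h1, Finset.sum_mul]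
      refine Finset.sum_congr rfl fun k _ => ?_
      rw [map_mul, Matrix.map_apply]; ring
    · simp
  rw [this]
  exact Ideal.sum_mem _ fun i _ => Ideal.sum_mem _ fun k _ =>
    Ideal.mul_mem_left _ _ (Ideal.mem_map_of_mem _ (hgen i k))

end

section

theorem exists_mem_map_of_mul_C_mem {B τ : Type} [CommRing B] [IsDomain B] [Finite τ]
    (I : Ideal (MvPolynomial τ B)) :
    ∃ h : B, h ≠ 0 ∧ ∀ (B' : Type) [CommRing B'] [IsDomain B'] (ρ : B →+* B'), ρ h ≠ 0 →
      (∀ x, x * C (ρ h) ∈ I.map (map ρ) → x ∈ I.map (map ρ)) →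
      ∀ b, b ≠ 0 → ∀ x, x * C b ∈ I.map (map ρ) → x ∈ I.map (map ρ) := by
  obtain ⟨h, hh, H⟩ := exists_normalForm_map I
  refine ⟨h, hh, fun B' _ _ ρ hρ hx b hb x hxb => ?_⟩
  set M := Localization.Away (ρ h)
  have hle := powers_le_nonZeroDivisors_of_noZeroDivisors hρ
  have hinj : Function.Injective (algebraMap B' M) := IsLocalization.injective M hle
  have : IsDomain M := IsLocalization.isDomain_localization hle
  obtain ⟨θ, h1, h2⟩ := H M ((algebraMap B' M).comp ρ)
    (IsLocalization.Away.algebraMap_isUnit (ρ h))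
  have hI : I.map (map ((algebraMap B' M).comp ρ)) =
      (I.map (map ρ)).map (map (algebraMap B' M)) := by
    rw [Ideal.map_map]
    congr 1
    exact RingHom.ext fun x => (map_map _ _ x).symm
  rw [hI] at h1 h2
  have hθ : algebraMap B' M b • θ (map (algebraMap B' M) x) = 0 := by
    rw [← map_smul, smul_eq_C_mul, ← map_C, ← map_mul, mul_comm]
    exact h1 _ (Ideal.mem_map_of_mem _ hxb)
  have hθ0 := (smul_eq_zero.1 hθ).resolve_left ((map_ne_zero_iff _ hinj).2 hb)
  have hmem := h2 (map (algebraMap B' M) x)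
  rw [hθ0, sub_zero] at hmem
  obtain ⟨N, y, hy, hxy⟩ := exists_pow_mul_mem_map (ρ h) _ hmem
  rw [← map_mul] at hxy
  have hpow : ∀ N, C (ρ h ^ N) * x ∈ I.map (map ρ) → x ∈ I.map (map ρ) := fun N => by
    induction N with
    | zero => simp
    | succ N ih =>
      intro hN
      refine ih (hx _ ?_)
      rwa [mul_right_comm, ← C_mul, ← pow_succ]
  refine hpow N ?_
  rw [map_injective _ hinj hxy]
  exact hy

variable {A σ : Type} [CommRing A] [IsDomain A] [Finite σ]

/-- Elements outside a prime stay non-zero-divisors modulo the prime after a generic change of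
coefficients. -/
theorem generically_mem_map_of_mul_mem {P : Ideal (MvPolynomial σ A)} [P.IsPrime]
    {g : MvPolynomial σ A} (hg : g ∉ P) :
    Generically fun _ _ ρ => ∀ x, x * map ρ g ∈ P.map (map ρ) → x ∈ P.map (map ρ) :=
  generically_colon_map fun _ hx => (‹P.IsPrime›.mem_or_mem hx).resolve_right hg

/-- Regard a polynomial as a polynomial in the variables outside `s`. -/
def splitVars (R : Type) [CommRing R] (s : Set σ) :
    MvPolynomial σ R ≃+* MvPolynomial ↥sᶜ (MvPolynomial s R) :=
  open Classical in
  ((renameEquiv R ((Equiv.sumComm _ _).trans (Equiv.Set.sumCompl s)).symm).trans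
    (sumAlgEquiv R ↥sᶜ s)).toRingEquiv

omit [Finite σ] in
theorem splitVars_rename (R : Type) [CommRing R] (s : Set σ) (p : MvPolynomial s R) :
    splitVars R s (rename (↑) p) = C p := by
  classical
  have : (splitVars R s : MvPolynomial σ R →+* MvPolynomial ↥sᶜ (MvPolynomial s R)).comp
      (rename (↑) : MvPolynomial s R →ₐ[R] _).toRingHom = C := by
    refine ringHom_ext (fun a => ?_) fun i => ?_
    · simp [splitVars]
    · simp [splitVars]
  exact DFunLike.congr_fun this p

omit [Finite σ] [IsDomain A] in
theorem splitVars_map {F : Type} [CommRing F] (ρ : A →+* F) (s : Set σ) (p : MvPolynomial σ A) :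
    splitVars F s (map ρ p) = map (map ρ) (splitVars A s p) := by
  classical
  have : (splitVars F s : MvPolynomial σ F →+* MvPolynomial ↥sᶜ (MvPolynomial s F)).comp
      (map ρ) = (map (map ρ)).comp (splitVars A s : MvPolynomial σ A →+* _) := by
    refine ringHom_ext (fun a => ?_) fun i => ?_
    · simp [splitVars]
    · obtain ⟨i, rfl⟩ := ((Equiv.sumComm _ _).trans (Equiv.Set.sumCompl s)).surjective i
      rcases i with i | i <;> simp [splitVars]
  exact DFunLike.congr_fun this p

/-- Elements in few variables are generically non-zero-divisors modulo a prime meeting the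
polynomials in these variables trivially. -/
theorem generically_mem_map_of_mul_rename_mem {P : Ideal (MvPolynomial σ A)} [P.IsPrime]
    {s : Set σ} (hs : ∀ p : MvPolynomial s A, rename (↑) p ∈ P → p = 0) :
    Generically fun F _ ρ => ∀ p : MvPolynomial s F, p ≠ 0 →
      ∀ x, x * rename (↑) p ∈ P.map (map ρ) → x ∈ P.map (map ρ) := by
  obtain ⟨h, hh, H⟩ := exists_mem_map_of_mul_C_mem
    (P.map (splitVars A s : MvPolynomial σ A →+* MvPolynomial ↥sᶜ (MvPolynomial s A)))
  refine ((generically_map_ne_zero hh).and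
    (generically_mem_map_of_mul_mem fun h' => hh (hs h h'))).mono ?_
  rintro F _ ρ ⟨hρ, hnzd⟩ p hp x hx
  have hP : (P.map (splitVars A s : MvPolynomial σ A →+*
      MvPolynomial ↥sᶜ (MvPolynomial s A))).map (map (map ρ)) =
      (P.map (map ρ)).map (splitVars F s : MvPolynomial σ F →+* _) := by
    rw [Ideal.map_map, Ideal.map_map]
    congr 1
    exact RingHom.ext fun x => (splitVars_map ρ s x).symm
  have hmem : ∀ y, splitVars F s y ∈
      (P.map (map ρ)).map (splitVars F s : MvPolynomial σ F →+* _) ↔ y ∈ P.map (map ρ) := fun y =>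
    Ideal.mem_map_of_equiv (splitVars F s) _ |>.trans ⟨fun ⟨z, hz, hzy⟩ =>
      (splitVars F s).injective hzy ▸ hz, fun hy => ⟨y, hy, rfl⟩⟩
  have := H (MvPolynomial s F) (map ρ) hρ (by
    intro y hy
    obtain ⟨y, rfl⟩ := (splitVars F s).surjective y
    rw [← splitVars_rename, ← map_mul, hP, hmem] at hy
    rw [hP, hmem]
    refine hnzd y ?_
    rwa [map_rename]) p hp (splitVars F s x)
  rw [← splitVars_rename, ← map_mul, hP, hmem, hmem] at this
  exact this hx

end

section

/-- Substitute a variable for the unknown of a polynomial with coefficients in few variables. -/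
def adjoinVar {σ : Type} (R : Type) [CommRing R] (s : Set σ) (j : σ) :
    Polynomial (MvPolynomial s R) →+* MvPolynomial σ R :=
  Polynomial.eval₂RingHom (rename (↑) : MvPolynomial s R →ₐ[R] _).toRingHom (X j)

theorem adjoinVar_map {σ R F : Type} [CommRing R] [CommRing F] (ρ : R →+* F) (s : Set σ) (j : σ)
    (q : Polynomial (MvPolynomial s R)) :
    adjoinVar F s j (q.map (map ρ)) = map ρ (adjoinVar R s j q) := by
  have : (adjoinVar F s j).comp (Polynomial.mapRingHom (map ρ)) =
      (map ρ).comp (adjoinVar R s j) := by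
    refine Polynomial.ringHom_ext' (ringHom_ext (fun a => ?_) fun i => ?_) ?_ <;> simp [adjoinVar]
  exact DFunLike.congr_fun this q

theorem exists_adjoinVar_eq_rename {σ R : Type} [CommRing R] {s : Set σ} {j : σ} (hj : j ∉ s)
    {p : MvPolynomial ↥(insert j s) R} (hp : p ≠ 0) :
    ∃ q : Polynomial (MvPolynomial s R), q ≠ 0 ∧ adjoinVar R s j q = rename (↑) p := by
  classical
  let e : ↥(insert j s) ≃ Option s :=
    (Equiv.Set.insert hj).trans (Equiv.optionEquivSumPUnit s).symm
  refine ⟨optionEquivLeft R s (rename e p), ?_, ?_⟩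
  · rw [Ne, EmbeddingLike.map_eq_zero_iff, ← map_zero (rename e), (rename_injective e
      e.injective).eq_iff]
    exact hp
  · have : ((adjoinVar R s j).comp (optionEquivLeft R s : _ →+* _)).comp (rename e).toRingHom =
        (rename (R := R) ((↑) : ↥(insert j s) → σ)).toRingHom := by
      refine ringHom_ext (fun a => ?_) fun i => ?_
      · simp [adjoinVar]
      · obtain ⟨i, rfl⟩ := e.symm.surjective i
        rcases i with _ | i <;> simp [adjoinVar, e]
    exact DFunLike.congr_fun this p

variable {A σ : Type} [CommRing A] [Finite σ]

theorem exists_maximal_independent_vars {P : Ideal (MvPolynomial σ A)}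
    (hP : ∀ a, C a ∈ P → a = 0) :
    ∃ s : Set σ, (∀ p : MvPolynomial s A, rename (↑) p ∈ P → p = 0) ∧
      ∀ j ∉ s, ∃ q, q ≠ 0 ∧ adjoinVar A s j q ∈ P := by
  let IsInd : Set σ → Prop := fun s => ∀ p : MvPolynomial s A, rename (↑) p ∈ P → p = 0
  have h0 : IsInd ∅ := fun p hp => by
    obtain ⟨a, rfl⟩ := C_surjective (∅ : Set σ) p
    rw [rename_C] at hp
    rw [hP _ hp, C_0]
  obtain ⟨s, hs⟩ := (Set.toFinite {s | IsInd s}).exists_maximal ⟨∅, h0⟩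
  refine ⟨s, hs.prop, fun j hj => ?_⟩
  have h1 : ¬ IsInd (insert j s) := fun h =>
    hj (hs.le_of_ge (y := insert j s) h (Set.subset_insert _ _) (Set.mem_insert _ _))
  simp only [IsInd, not_forall] at h1
  obtain ⟨p, hp, hp0⟩ := h1
  obtain ⟨q, hq0, hq⟩ := exists_adjoinVar_eq_rename hj hp0
  exact ⟨q, hq0, hq ▸ hp⟩

omit [Finite σ] in
/-- Primes over an ideal are maximal with respect to meeting trivially a set of variables over
which the remaining ones are algebraic. -/
theorem eq_of_le_of_adjoinVar_mem {F : Type} [Field F] {s : Set σ} {Q P : Ideal (MvPolynomial σ F)}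
    [Q.IsPrime] (hQP : Q ≤ P) (hP : ∀ p : MvPolynomial s F, rename (↑) p ∈ P → p = 0)
    (hQ : ∀ j ∉ s, ∃ q, q ≠ 0 ∧ adjoinVar F s j q ∈ Q) : Q = P := by
  refine le_antisymm hQP fun z hz => ?_
  by_contra hzQ
  let _ : Algebra (MvPolynomial s F) (MvPolynomial σ F ⧸ Q) :=
    ((Ideal.Quotient.mk Q).comp (rename (↑) : MvPolynomial s F →ₐ[F] _).toRingHom).toAlgebra
  have hmk : ∀ p, algebraMap (MvPolynomial s F) (MvPolynomial σ F ⧸ Q) p =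
    Ideal.Quotient.mk Q (rename (↑) p) := fun p => rfl
  have halg : ∀ x : MvPolynomial σ F, IsAlgebraic (MvPolynomial s F) (Ideal.Quotient.mk Q x) := by
    intro x
    induction x using MvPolynomial.induction_on with
    | C a =>
      rw [← rename_C ((↑) : s → σ), ← hmk]
      exact isAlgebraic_algebraMap _
    | add x y hx hy => rw [map_add]; exact hx.add hy
    | mul_X x j hx =>
      rw [map_mul]
      refine hx.mul ?_
      by_cases hj : j ∈ s
      · have : (X j : MvPolynomial σ F) = rename (↑) (X (⟨j, hj⟩ : s)) := by rw [rename_X]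
        rw [this, ← hmk]
        exact isAlgebraic_algebraMap _
      · obtain ⟨q, hq0, hq⟩ := hQ j hj
        refine ⟨q, hq0, ?_⟩
        rw [Polynomial.aeval_def, RingHom.algebraMap_toAlgebra, ← Polynomial.hom_eval₂]
        exact Ideal.Quotient.eq_zero_iff_mem.2 hq
  refine Ideal.comap_ne_bot_of_algebraic_mem (I := P.map (Ideal.Quotient.mk Q))
    (x := Ideal.Quotient.mk Q z) ?_ (Ideal.mem_map_of_mem _ hz) (halg z) ?_
  · rwa [Ne, Ideal.Quotient.eq_zero_iff_mem]
  · rw [eq_bot_iff]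
    intro p hp
    rw [Ideal.mem_comap, hmk, Ideal.mem_quotient_iff_mem hQP] at hp
    exact hP p hp

/-- Generically, the associated primes of the extension of a prime are minimal. -/
theorem generically_eq_of_le_of_annihilates [IsDomain A] {P : Ideal (MvPolynomial σ A)} [P.IsPrime]
    (hP : ∀ a, C a ∈ P → a = 0) :
    Generically fun F _ ρ => ∀ 𝔭 : Ideal (MvPolynomial σ F),
      (∃ y, y ∉ P.map (map ρ) ∧ ∀ z ∈ 𝔭, y * z ∈ P.map (map ρ)) →
      ∀ 𝔮 : Ideal (MvPolynomial σ F), 𝔮.IsPrime → P.map (map ρ) ≤ 𝔮 → 𝔮 ≤ 𝔭 → 𝔮 = 𝔭 := by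
  obtain ⟨s, hs, hj⟩ := exists_maximal_independent_vars hP
  choose q hq0 hq using hj
  have hqρ : ∀ j : ↥sᶜ, Generically fun (F : Type) [Field F] (ρ : A →+* F) =>
      (q j j.2).map (map ρ) ≠ 0 := fun j => by
    obtain ⟨N, hN⟩ : ∃ N, (q j j.2).coeff N ≠ 0 := by
      by_contra! h
      exact hq0 j j.2 (Polynomial.ext h)
    refine (generically_map_ne_zero hN).mono fun F _ ρ h h0 => h ?_
    rw [← Polynomial.coeff_map, h0, Polynomial.coeff_zero]
  refine ((generically_mem_map_of_mul_rename_mem hs).and (Generically.forall_finite hqρ)).mono ?_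
  rintro F _ ρ ⟨h1, h2⟩ 𝔭 ⟨y, hy, hy𝔭⟩ 𝔮 _ hP𝔮 h𝔮𝔭
  refine eq_of_le_of_adjoinVar_mem (s := s) h𝔮𝔭 (fun p hp => ?_) fun j hj => ?_
  · by_contra hp0
    exact hy (h1 p hp0 y (hy𝔭 _ hp))
  · refine ⟨_, h2 ⟨j, hj⟩, hP𝔮 ?_⟩
    rw [adjoinVar_map]
    exact Ideal.mem_map_of_mem _ (hq j hj)

end

section

theorem le_comap_quotientMk {R : Type*} [CommRing R] {I : Ideal R} (J : Ideal (R ⧸ I)) :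
    I ≤ J.comap (Ideal.Quotient.mk I) := fun x hx => by
  rw [Ideal.mem_comap, Ideal.Quotient.eq_zero_iff_mem.2 hx]
  exact J.zero_mem

theorem exists_mul_pow_mem_of_mem_minimalPrimes {R : Type*} [CommRing R] {P J : Ideal R}
    [P.IsPrime] (hPJ : P ∈ J.minimalPrimes) {z : R} (hz : z ∈ P) :
    ∃ g ∉ P, ∃ N : ℕ, g * z ^ N ∈ J := by
  have h := IsLocalization.AtPrime.radical_map_of_mem_minimalPrimes
    (Localization.AtPrime P) P J hPJ
  obtain ⟨N, hN⟩ := h.ge (Ideal.mem_map_of_mem _ hz)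
  rw [← map_pow, IsLocalization.algebraMap_mem_map_algebraMap_iff P.primeCompl] at hN
  obtain ⟨g, hg, hgz⟩ := hN
  exact ⟨g, hg, N, hgz⟩

/-- The prime ideal `℘` is associated to the ideal `I`. -/
def IsAssPrime {R : Type*} [CommRing R] (I ℘ : Ideal R) : Prop :=
  ℘.IsPrime ∧ ∃ y, ∀ z, z ∈ ℘ ↔ y * z ∈ I

theorem IsAssPrime.notMem {R : Type*} [CommRing R] {I ℘ : Ideal R} (h : IsAssPrime I ℘) {g : R}
    (hg : ∀ x, x * g ∈ I → x ∈ I) : g ∉ ℘ := by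
  obtain ⟨h℘, y, hy⟩ := h
  refine fun hg℘ => h℘.one_notMem ((hy 1).2 ?_)
  rw [mul_one]
  exact hg y ((hy g).1 hg℘)

theorem IsAssPrime.le {R : Type*} [CommRing R] {I ℘ : Ideal R} (h : IsAssPrime I ℘) : I ≤ ℘ := by
  obtain ⟨-, y, hy⟩ := h
  exact fun z hz => (hy z).2 (I.mul_mem_left y hz)

variable {A σ : Type} [CommRing A] [IsDomain A] [Finite σ]

theorem generically_notMem {P : Ideal (MvPolynomial σ A)} [P.IsPrime] {g : MvPolynomial σ A}
    (hg : g ∉ P) :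
    Generically fun _ _ ρ => ∀ ℘, IsAssPrime (P.map (map ρ)) ℘ → map ρ g ∉ ℘ :=
  (generically_mem_map_of_mul_mem hg).mono fun _ _ _ h _ h℘ => h℘.notMem h

theorem generically_le_height (H : Ideal (MvPolynomial σ A)) (d : ℕ) :
    ∀ Q : Ideal (MvPolynomial σ A), Q.IsPrime → H ≤ Q →
      (d : ℕ∞) ≤ (Q.map (Ideal.Quotient.mk H)).height →
      Generically fun F _ ρ => ∀ 𝔭 : Ideal (MvPolynomial σ F), 𝔭.IsPrime →
        Q.map (map ρ) ≤ 𝔭 →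
        (d : ℕ∞) ≤ (𝔭.map (Ideal.Quotient.mk (H.map (map ρ)))).height := by
  induction d with
  | zero => exact fun _ _ _ _ => ⟨1, one_ne_zero, fun F _ ρ _ 𝔭 _ _ => by simp⟩
  | succ d ih =>
    intro Q hQ hHQ hd
    have := Ideal.isPrime_map_quotientMk_of_isPrime hHQ
    have hlt : ¬ (Q.map (Ideal.Quotient.mk H)).height ≤ d := fun h => by
      have := hd.trans h
      norm_cast at this
      omega
    rw [Ideal.height_le_iff] at hlt
    push Not at hlt
    obtain ⟨q, hq, hqQ, hdq⟩ := hlt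
    have hHq : H ≤ q.comap (Ideal.Quotient.mk H) := le_comap_quotientMk q
    have hqq : (q.comap (Ideal.Quotient.mk H)).map (Ideal.Quotient.mk H) = q :=
      Ideal.map_comap_of_surjective _ Ideal.Quotient.mk_surjective _
    obtain ⟨x, hxQ, hxq⟩ := SetLike.exists_of_lt hqQ
    obtain ⟨g, rfl⟩ := Ideal.Quotient.mk_surjective x
    have hgQ : g ∈ Q := (Ideal.mem_quotient_iff_mem hHQ).1 hxQ
    have hgq : g ∉ q.comap (Ideal.Quotient.mk H) := hxq
    refine ((ih _ (hq.comap _) hHq (by rwa [hqq])).and (generically_mem_map_of_mul_mem hgq)).mono ?_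
    rintro F _ ρ ⟨h1, h2⟩ 𝔭 h𝔭 hQ𝔭
    have hle : q.comap (Ideal.Quotient.mk H) ≤ Q := fun z hz =>
      (Ideal.mem_quotient_iff_mem hHQ).1 (hqQ.le hz)
    obtain ⟨𝔮, h𝔮, h𝔮𝔭⟩ := Ideal.exists_minimalPrimes_le ((Ideal.map_mono hle).trans hQ𝔭)
    have hg𝔮 : map ρ g ∉ 𝔮 := fun hmem => by
      obtain ⟨y, hy, hgy⟩ := Ideal.exists_mul_mem_of_mem_minimalPrimes h𝔮 hmem
      exact hy (h2 y (by rwa [mul_comm]))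
    have := h𝔮.1.1
    have hH𝔮 : H.map (map ρ) ≤ 𝔮 := (Ideal.map_mono hHq).trans h𝔮.1.2
    have hH𝔭 := hH𝔮.trans h𝔮𝔭
    have := Ideal.isPrime_map_quotientMk_of_isPrime hH𝔮
    have := Ideal.isPrime_map_quotientMk_of_isPrime hH𝔭
    have hlt : 𝔮.map (Ideal.Quotient.mk (H.map (map ρ))) <
        𝔭.map (Ideal.Quotient.mk (H.map (map ρ))) := by
      refine SetLike.lt_iff_le_and_exists.2 ⟨Ideal.map_mono h𝔮𝔭,
        Ideal.Quotient.mk _ (map ρ g), ?_, ?_⟩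
      · exact Ideal.mem_map_of_mem _ (hQ𝔭 (Ideal.mem_map_of_mem _ hgQ))
      · rwa [Ideal.mem_quotient_iff_mem hH𝔮]
    refine le_trans ?_ (Ideal.height_add_one_le_of_lt_of_isPrime hlt)
    rw [Nat.cast_add, Nat.cast_one]
    gcongr
    exact h1 𝔮 h𝔮.1.1 h𝔮.1.2

theorem generically_height_le [IsNoetherianRing A] {H P : Ideal (MvPolynomial σ A)} [P.IsPrime]
    (hP : ∀ a, C a ∈ P → a = 0) (hHP : H ≤ P) :
    Generically fun F _ ρ => ∀ ℘ : Ideal (MvPolynomial σ F), IsAssPrime (P.map (map ρ)) ℘ →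
      (℘.map (Ideal.Quotient.mk (H.map (map ρ)))).height ≤
        (P.map (Ideal.Quotient.mk H)).height := by
  classical
  have := Ideal.isPrime_map_quotientMk_of_isPrime hHP
  obtain ⟨s, hs, hcard⟩ := Ideal.exists_finset_card_eq_height_of_isNoetherianRing
    (P.map (Ideal.Quotient.mk H))
  have hPJ : P ∈ ((Ideal.span (s : Set _)).comap (Ideal.Quotient.mk H)).minimalPrimes := by
    refine ⟨⟨‹_›, fun z hz => (Ideal.mem_quotient_iff_mem hHP).1 (hs.1.2 hz)⟩, ?_⟩
    rintro 𝔮 ⟨h𝔮, hJ𝔮⟩ h𝔮P z hz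
    have hH𝔮 : H ≤ 𝔮 := (le_comap_quotientMk _).trans hJ𝔮
    have := Ideal.isPrime_map_quotientMk_of_isPrime hH𝔮
    refine (Ideal.mem_quotient_iff_mem hH𝔮).1
      (hs.2 ⟨this, ?_⟩ (Ideal.map_mono h𝔮P) (Ideal.mem_map_of_mem _ hz))
    exact (Ideal.map_comap_of_surjective _ Ideal.Quotient.mk_surjective _).ge.trans
      (Ideal.map_mono hJ𝔮)
  obtain ⟨t, ht⟩ := IsNoetherian.noetherian P
  have htP : ∀ z : t, (z : MvPolynomial σ A) ∈ P := fun z => by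
    rw [← ht]; exact Ideal.subset_span z.2
  choose g hg N hgN using fun z : t => exists_mul_pow_mem_of_mem_minimalPrimes hPJ (htP z)
  refine ((Generically.forall_finite fun z => generically_notMem (hg z)).and
    (generically_eq_of_le_of_annihilates hP)).mono ?_
  rintro F _ ρ ⟨h1, h2⟩ ℘ h℘
  let φ : MvPolynomial σ A ⧸ H →+* MvPolynomial σ F ⧸ H.map (map ρ) :=
    Ideal.quotientMap _ (map ρ) Ideal.le_comap_map
  have hφ : ∀ x, φ (Ideal.Quotient.mk H x) = Ideal.Quotient.mk _ (map ρ x) := fun x =>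
    Ideal.quotientMap_mk
  have h℘p := h℘.1
  have hH℘ : H.map (map ρ) ≤ ℘ := (Ideal.map_mono hHP).trans h℘.le
  have hmin : ℘.map (Ideal.Quotient.mk (H.map (map ρ))) ∈
      (Ideal.span ((s.image φ : Finset _) : Set _)).minimalPrimes := by
    rw [Finset.coe_image, ← Ideal.map_span]
    refine ⟨⟨Ideal.isPrime_map_quotientMk_of_isPrime hH℘, ?_⟩, ?_⟩
    · refine (Ideal.map_mono hs.1.2).trans ?_
      rw [Ideal.map_map, Ideal.map_le_iff_le_comap]
      intro z hz
      rw [Ideal.mem_comap, RingHom.comp_apply, hφ]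
      exact Ideal.mem_map_of_mem _ (h℘.le (Ideal.mem_map_of_mem _ hz))
    · rintro 𝔮 ⟨h𝔮, hs𝔮⟩ h𝔮℘
      have h𝔮le : 𝔮.comap (Ideal.Quotient.mk _) ≤ ℘ := fun z hz =>
        (Ideal.mem_quotient_iff_mem hH℘).1 (h𝔮℘ hz)
      have hP𝔮 : P.map (map ρ) ≤ 𝔮.comap (Ideal.Quotient.mk _) := by
        rw [← ht, Ideal.submodule_span_eq, Ideal.map_span, Ideal.span_le]
        rintro _ ⟨z, hz, rfl⟩
        have hmem : map ρ (g ⟨z, hz⟩) * map ρ z ^ N ⟨z, hz⟩ ∈ 𝔮.comap (Ideal.Quotient.mk _) := by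
          rw [← map_pow, ← map_mul, Ideal.mem_comap, ← hφ]
          exact hs𝔮 (Ideal.mem_map_of_mem _ (hgN ⟨z, hz⟩))
        have hp : (𝔮.comap (Ideal.Quotient.mk (H.map (map ρ)))).IsPrime := h𝔮.comap _
        exact hp.mem_of_pow_mem _ ((hp.mem_or_mem hmem).resolve_left
          fun h => h1 ⟨z, hz⟩ ℘ h℘ (h𝔮le h))
      obtain ⟨y, hy⟩ := h℘.2
      have := h2 ℘ ⟨y, fun hyP => h℘p.one_notMem ((hy 1).2 (by rwa [mul_one])),
        fun z => (hy z).1⟩ _ (h𝔮.comap _) hP𝔮 h𝔮le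
      rw [← this, Ideal.map_comap_of_surjective _ Ideal.Quotient.mk_surjective]
  refine (Ideal.height_le_card_of_mem_minimalPrimes_span_finset hmin).trans ?_
  rw [← hcard]
  exact_mod_cast Finset.card_image_le

theorem ringKrullDim_quotient_map_algebraMap {R S : Type*} [CommRing R] [CommRing S] [Algebra R S]
    (P : Ideal R) [P.IsPrime] [IsLocalization.AtPrime S P] {H : Ideal R} (hHP : H ≤ P) :
    ringKrullDim (S ⧸ H.map (algebraMap R S)) = (P.map (Ideal.Quotient.mk H)).height := by
  have := Ideal.isPrime_map_quotientMk_of_isPrime hHP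
  have : IsLocalization.AtPrime (S ⧸ H.map (algebraMap R S)) (P.map (Ideal.Quotient.mk H)) := by
    have hM : Algebra.algebraMapSubmonoid (R ⧸ H) P.primeCompl =
        (P.map (Ideal.Quotient.mk H)).primeCompl := by
      ext x
      obtain ⟨x, rfl⟩ := Ideal.Quotient.mk_surjective x
      rw [Ideal.mem_primeCompl_iff, Ideal.mem_quotient_iff_mem hHP]
      constructor
      · rintro ⟨y, hy, hyx⟩ hx
        have := Ideal.Quotient.eq.1 hyx
        exact hy ((Submodule.sub_mem_iff_left _ hx).1 (hHP this))
      · exact fun hx => ⟨x, hx, rfl⟩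
    rw [IsLocalization.AtPrime, ← hM]
    infer_instance
  exact IsLocalization.AtPrime.ringKrullDim_eq_height _ _

theorem ringKrullDim_quotient_map_algebraMap_of_mem {R S : Type*} [CommRing R] [CommRing S]
    [Algebra R S] (P : Ideal R) [P.IsPrime] [IsLocalization.AtPrime S P] {H : Ideal R} {g : R}
    (hgH : g ∈ H) (hgP : g ∉ P) : ringKrullDim (S ⧸ H.map (algebraMap R S)) = ⊥ := by
  have : H.map (algebraMap R S) = ⊤ := Ideal.eq_top_of_isUnit_mem _ (Ideal.mem_map_of_mem _ hgH)
    (IsLocalization.map_units S (⟨g, hgP⟩ : P.primeCompl))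
  have := Ideal.Quotient.subsingleton_iff.2 this
  exact ringKrullDim_eq_bot_of_subsingleton

/-- Generically, the dimension of a quotient of a local ring is preserved. -/
theorem generically_ringKrullDim_eq [IsNoetherianRing A] (H P : Ideal (MvPolynomial σ A))
    [P.IsPrime] (hP : ∀ a, C a ∈ P → a = 0) (S : Type) [CommRing S] [Algebra (MvPolynomial σ A) S]
    [IsLocalization.AtPrime S P] :
    Generically fun F _ ρ => ∀ (℘ : Ideal (MvPolynomial σ F)) [℘.IsPrime],
      IsAssPrime (P.map (map ρ)) ℘ →
      ∀ (S' : Type) [CommRing S'] [Algebra (MvPolynomial σ F) S'] [IsLocalization.AtPrime S' ℘],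
        ringKrullDim (S' ⧸ (H.map (map ρ)).map (algebraMap (MvPolynomial σ F) S')) =
          ringKrullDim (S ⧸ H.map (algebraMap (MvPolynomial σ A) S)) := by
  by_cases hHP : H ≤ P
  · have := Ideal.isPrime_map_quotientMk_of_isPrime hHP
    obtain ⟨d, hd⟩ := ENat.ne_top_iff_exists.1
      (Ideal.height_ne_top_of_isPrime (I := P.map (Ideal.Quotient.mk H)))
    refine ((generically_height_le hP hHP).and
      (generically_le_height H d P ‹_› hHP hd.le)).mono ?_
    rintro F _ ρ ⟨h1, h2⟩ ℘ _ h℘ S' _ _ _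
    rw [ringKrullDim_quotient_map_algebraMap P hHP, ringKrullDim_quotient_map_algebraMap ℘
      ((Ideal.map_mono hHP).trans h℘.le)]
    rw [le_antisymm (h1 ℘ h℘) (hd ▸ h2 ℘ ‹_› h℘.le)]
  · obtain ⟨g, hgH, hgP⟩ := SetLike.not_le_iff_exists.1 hHP
    refine (generically_notMem hgP).mono fun F _ ρ h ℘ _ h℘ S' _ _ _ => ?_
    rw [ringKrullDim_quotient_map_algebraMap_of_mem P hgH hgP,
      ringKrullDim_quotient_map_algebraMap_of_mem ℘ (Ideal.mem_map_of_mem _ hgH) (h ℘ h℘)]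

end

section Annihilator

variable {R S : Type} [CommRing R] [CommRing S] {r s : ℕ}

theorem mem_annihilator_matCoker {f : Matrix (Fin r) (Fin s) R} {x : R} :
    x ∈ Module.annihilator R (MatCoker f) ↔ ∀ i, ∃ v, f.mulVec v = Pi.single i x := by
  have h : x ∈ Module.annihilator R (MatCoker f) ↔
      ∀ w : Fin r → R, ∃ v, f.mulVec v = x • w := by
    rw [Module.mem_annihilator]
    refine ⟨fun h w => ?_, fun h w => ?_⟩
    · have := h (Submodule.Quotient.mk w)
      rwa [← Submodule.Quotient.mk_smul, Submodule.Quotient.mk_eq_zero] at this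
    · obtain ⟨w, rfl⟩ := Submodule.Quotient.mk_surjective _ w
      rw [← Submodule.Quotient.mk_smul, Submodule.Quotient.mk_eq_zero]
      exact h w
  rw [h]
  refine ⟨fun h i => ?_, fun h w => ?_⟩
  · obtain ⟨v, hv⟩ := h (Pi.single i 1)
    exact ⟨v, by rw [hv, ← Pi.single_smul, smul_eq_mul, mul_one]⟩
  · choose v hv using h
    refine ⟨∑ i, w i • v i, ?_⟩
    rw [Matrix.mulVec_sum]
    simp_rw [Matrix.mulVec_smul, hv]
    ext j
    rw [Finset.sum_apply, Finset.sum_eq_single j]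
    · simp [mul_comm]
    · intro i _ hi
      simp [Pi.single_eq_of_ne hi.symm]
    · simp

theorem map_mulVec (φ : R →+* S) (f : Matrix (Fin r) (Fin s) R) (v : Fin s → R) :
    (f.map φ).mulVec (φ ∘ v) = φ ∘ f.mulVec v := by
  ext i
  exact (RingHom.map_mulVec φ f v i).symm

theorem comp_single (φ : R →+* S) (i : Fin r) (x : R) :
    φ ∘ Pi.single i x = Pi.single i (φ x) := by
  ext j
  exact Pi.apply_single (fun _ => φ) (fun _ => map_zero φ) i x j

theorem map_annihilator_matCoker_le (φ : R →+* S) (f : Matrix (Fin r) (Fin s) R) :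
    (Module.annihilator R (MatCoker f)).map φ ≤ Module.annihilator S (MatCoker (f.map φ)) := by
  rw [Ideal.map_le_iff_le_comap]
  intro x hx
  rw [mem_annihilator_matCoker] at hx
  rw [Ideal.mem_comap, mem_annihilator_matCoker]
  intro i
  obtain ⟨v, hv⟩ := hx i
  exact ⟨φ ∘ v, by rw [map_mulVec, hv, comp_single]⟩

theorem annihilator_matCoker_of_isUnit_mul {A A' : Matrix (Fin r) (Fin s) S} {u : S}
    (hu : IsUnit u) (h : ∀ i j, A i j * u = A' i j) :
    Module.annihilator S (MatCoker A) = Module.annihilator S (MatCoker A') := by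
  obtain ⟨u, rfl⟩ := hu
  have hA : A' = (u : S) • A := by
    ext i j
    rw [← h, Matrix.smul_apply, smul_eq_mul, mul_comm]
  ext x
  simp_rw [mem_annihilator_matCoker]
  refine forall_congr' fun i => ⟨fun ⟨v, hv⟩ => ⟨((u⁻¹ : Sˣ) : S) • v, ?_⟩,
    fun ⟨v, hv⟩ => ⟨(u : S) • v, ?_⟩⟩
  · rw [hA, Matrix.mulVec_smul, Matrix.smul_mulVec, hv, smul_smul, Units.inv_mul, one_smul]
  · rw [← hv, hA, Matrix.mulVec_smul, Matrix.smul_mulVec]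

theorem Present.annihilator_eq {L : Type} [AddCommGroup L] [Module S L] (p : Present S r s L) :
    Module.annihilator S L = Module.annihilator S (MatCoker p.A) :=
  ((Submodule.quotEquivOfEq _ _ p.ker_eq.symm).trans
    (p.π.quotKerEquivOfSurjective p.surj)).annihilator_eq.symm

variable [Algebra R S]

theorem annihilator_matCoker_map_algebraMap (M : Submonoid R) [IsLocalization M S]
    (f : Matrix (Fin r) (Fin s) R) :
    Module.annihilator S (MatCoker (f.map (algebraMap R S))) =
      (Module.annihilator R (MatCoker f)).map (algebraMap R S) := by
  refine le_antisymm (fun y hy => ?_) (map_annihilator_matCoker_le _ f)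
  obtain ⟨⟨x, m⟩, hx⟩ := IsLocalization.surj M y
  have hu := IsLocalization.map_units S m
  rw [← Ideal.mul_unit_mem_iff_mem _ hu, hx, IsLocalization.algebraMap_mem_map_algebraMap_iff M]
  have hx' : algebraMap R S x ∈ Module.annihilator S (MatCoker (f.map (algebraMap R S))) := by
    rw [← hx]
    exact Ideal.mul_mem_right _ _ hy
  rw [mem_annihilator_matCoker] at hx'
  have key : ∀ i, ∃ e : M, ∃ v, f.mulVec v = Pi.single i (e * x) := fun i => by
    obtain ⟨v, hv⟩ := hx' i
    obtain ⟨d, hd⟩ := IsLocalization.exist_integer_multiples_of_finite M v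
    choose w hw using hd
    have hdv : (algebraMap R S ∘ w) = (algebraMap R S d) • v := by
      ext j
      rw [Function.comp_apply, hw, Pi.smul_apply, Algebra.smul_def, smul_eq_mul]
    have h1 : ∀ j, algebraMap R S (f.mulVec w j) =
        algebraMap R S ((Pi.single i (d * x) : Fin r → R) j) := fun j => by
      have h2 := map_mulVec (algebraMap R S) f w
      rw [hdv, Matrix.mulVec_smul, hv] at h2
      rw [← Function.comp_apply (f := algebraMap R S), ← h2,
        ← Function.comp_apply (f := algebraMap R S) (x := j), comp_single, ← Pi.single_smul,
        smul_eq_mul, map_mul]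
    choose c hc using fun j => IsLocalization.exists_of_eq (M := M) (h1 j)
    refine ⟨(∏ j, c j) * d, ((∏ j, c j : M) : R) • w, ?_⟩
    ext j
    rw [Matrix.mulVec_smul, Pi.smul_apply, smul_eq_mul,
      ← Finset.prod_erase_mul _ _ (Finset.mem_univ j),
      Submonoid.coe_mul, mul_assoc, hc j, ← mul_assoc, ← Submonoid.coe_mul,
      Finset.prod_erase_mul _ _ (Finset.mem_univ j), ← smul_eq_mul, ← Pi.smul_apply,
      ← Pi.single_smul, smul_eq_mul, Submonoid.coe_mul, mul_assoc]
  choose e v hv using key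
  refine ⟨((∏ i, e i : M) : R), (∏ i, e i : M).2, ?_⟩
  rw [mem_annihilator_matCoker]
  intro i
  refine ⟨((∏ j ∈ Finset.univ.erase i, e j : M) : R) • v i, ?_⟩
  rw [Matrix.mulVec_smul, hv, ← Pi.single_smul, smul_eq_mul, ← mul_assoc, ← Submonoid.coe_mul,
    Finset.prod_erase_mul _ _ (Finset.mem_univ i)]

/-- Fractions that generate the extension of an ideal to a localization specialize to generators,
provided a certain element of the multiplicative set is sent to a unit. -/
theorem exists_span_eq_map (M : Submonoid R) [IsLocalization M S]
    {I : Ideal R} (hI : I.FG) {t : ℕ} {a : Fin t → S}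
    (ha : Ideal.span (Set.range a) = I.map (algebraMap R S)) {g h : Fin t → R}
    (hg : ∀ i, g i ∈ M) (hgh : ∀ i, a i * algebraMap R S (g i) = algebraMap R S (h i)) :
    ∃ m ∈ M, ∀ (S' : Type) [CommRing S'] (ψ : R →+* S') (b : Fin t → S'), IsUnit (ψ m) →
      (∀ i, IsUnit (ψ (g i))) → (∀ i, b i * ψ (g i) = ψ (h i)) →
      Ideal.span (Set.range b) = I.map ψ := by
  classical
  have hw : ∀ i, ∃ w ∈ M, w * h i ∈ I := fun i => by
    rw [← IsLocalization.algebraMap_mem_map_algebraMap_iff M (S := S), ← ha, ← hgh]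
    exact Ideal.mul_mem_right _ _ (Ideal.subset_span ⟨i, rfl⟩)
  choose w hwM hw using hw
  obtain ⟨T, hT⟩ := hI
  have hq : ∀ x : T, ∃ q ∈ M, q * (x : R) ∈ Ideal.span (Set.range h) := fun x => by
    rw [← IsLocalization.algebraMap_mem_map_algebraMap_iff M (S := S)]
    have hx : algebraMap R S x ∈ I.map (algebraMap R S) :=
      Ideal.mem_map_of_mem _ (hT ▸ Ideal.subset_span x.2)
    rw [← ha] at hx
    refine Ideal.span_le.2 ?_ hx
    rintro _ ⟨i, rfl⟩
    rw [SetLike.mem_coe, ← Ideal.mul_unit_mem_iff_mem _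
      (IsLocalization.map_units S ⟨g i, hg i⟩), hgh]
    exact Ideal.mem_map_of_mem _ (Ideal.subset_span ⟨i, rfl⟩)
  choose q hqM hq using hq
  refine ⟨(∏ i, w i) * ∏ x, q x, mul_mem (prod_mem fun i _ => hwM i) (prod_mem fun x _ => hqM x),
    fun S' _ ψ b hm hgu hb => ?_⟩
  rw [map_mul, map_prod, map_prod, IsUnit.mul_iff, IsUnit.prod_univ_iff, IsUnit.prod_univ_iff] at hm
  refine le_antisymm (Ideal.span_le.2 ?_) ?_
  · rintro _ ⟨i, rfl⟩
    rw [SetLike.mem_coe, ← Ideal.mul_unit_mem_iff_mem _ (hgu i), hb,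
      ← Ideal.unit_mul_mem_iff_mem _ (hm.1 i), ← map_mul]
    exact Ideal.mem_map_of_mem _ (hw i)
  · rw [← hT, Ideal.map_span, Ideal.span_le]
    rintro _ ⟨x, hx, rfl⟩
    rw [SetLike.mem_coe, ← Ideal.unit_mul_mem_iff_mem _ (hm.2 ⟨x, hx⟩), ← map_mul]
    have hle : (Ideal.span (Set.range h)).map ψ ≤ Ideal.span (Set.range b) := by
      rw [Ideal.map_span, Ideal.span_le]
      rintro _ ⟨_, ⟨i, rfl⟩, rfl⟩
      rw [SetLike.mem_coe, ← hb]
      exact Ideal.mul_mem_right _ _ (Ideal.subset_span ⟨i, rfl⟩)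
    exact hle (Ideal.mem_map_of_mem _ (hq ⟨x, hx⟩))

end Annihilator

theorem generically_annihilator_and_moduleDim {A σ : Type} [CommRing A] [IsDomain A] [Finite σ]
    [IsNoetherianRing A] {P : Ideal (MvPolynomial σ A)} [P.IsPrime] (hP : ∀ a, C a ∈ P → a = 0)
    {S : Type} [CommRing S] [Algebra (MvPolynomial σ A) S] [IsLocalization.AtPrime S P]
    {r s t : ℕ} {N : Matrix (Fin r) (Fin s) S} {g₀ : MvPolynomial σ A} (hg₀ : g₀ ∉ P)
    {f : Matrix (Fin r) (Fin s) (MvPolynomial σ A)}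
    (hN : ∀ i j, N i j * algebraMap _ S g₀ = algebraMap _ S (f i j))
    {a : Fin t → S} (ha : Ideal.span (Set.range a) = Module.annihilator S (MatCoker N))
    {g h : Fin t → MvPolynomial σ A} (hg : ∀ i, g i ∉ P)
    (hgh : ∀ i, a i * algebraMap _ S (g i) = algebraMap _ S (h i)) :
    Generically fun F _ ρ => ∀ (℘ : Ideal (MvPolynomial σ F)) [℘.IsPrime],
      IsAssPrime (P.map (map ρ)) ℘ →
      ∀ (S' : Type) [CommRing S'] [Algebra (MvPolynomial σ F) S'] [IsLocalization.AtPrime S' ℘]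
        (B : Matrix (Fin r) (Fin s) S') (b : Fin t → S'),
        (∀ i j, B i j * algebraMap _ S' (map ρ g₀) = algebraMap _ S' (map ρ (f i j))) →
        (∀ i, b i * algebraMap _ S' (map ρ (g i)) = algebraMap _ S' (map ρ (h i))) →
        Module.annihilator S' (MatCoker B) = Ideal.span (Set.range b) ∧
        moduleDim S' (MatCoker B) = moduleDim S (MatCoker N) := by
  let I := Module.annihilator (MvPolynomial σ A) (MatCoker f)
  have hNI : Module.annihilator S (MatCoker N) = I.map (algebraMap _ S) :=
    (annihilator_matCoker_of_isUnit_mul (IsLocalization.map_units S (⟨g₀, hg₀⟩ : P.primeCompl))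
      hN).trans (annihilator_matCoker_map_algebraMap P.primeCompl f)
  obtain ⟨m, hm, hspan⟩ := exists_span_eq_map P.primeCompl (IsNoetherian.noetherian I)
    (ha.trans hNI) hg hgh
  refine ((generically_ringKrullDim_eq I P hP S).and
    ((generically_annihilator_map f fun x hx => mem_annihilator_matCoker.2 hx).and
    ((generically_notMem hg₀).and ((generically_notMem hm).and
    (Generically.forall_finite fun i => generically_notMem (hg i)))))).mono ?_
  rintro F _ ρ ⟨hdim, hann, hg₀', hm', hg'⟩ ℘ _ h℘ S' _ _ _ B b hB hb
  have hunit : ∀ x, x ∉ ℘ → IsUnit (algebraMap _ S' x) := fun x hx =>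
    IsLocalization.map_units S' (⟨x, hx⟩ : ℘.primeCompl)
  have hI : Module.annihilator (MvPolynomial σ F) (MatCoker (f.map (map ρ))) = I.map (map ρ) :=
    le_antisymm (fun x hx => hann x (mem_annihilator_matCoker.1 hx))
      (map_annihilator_matCoker_le _ f)
  have hBI : Module.annihilator S' (MatCoker B) = (I.map (map ρ)).map (algebraMap _ S') := by
    rw [← hI, ← annihilator_matCoker_map_algebraMap ℘.primeCompl]
    exact annihilator_matCoker_of_isUnit_mul (hunit _ (hg₀' ℘ h℘)) hB
  refine ⟨?_, ?_⟩
  · rw [hBI, Ideal.map_map]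
    exact (hspan S' ((algebraMap _ S').comp (map ρ)) b (hunit _ (hm' ℘ h℘))
      (fun i => hunit _ (hg' i ℘ h℘)) hb).symm
  · rw [moduleDim, moduleDim, hBI, hNI]
    exact hdim ℘ h℘ S'

theorem Generically.almostAll {k K : Type} [Field k] [Field K] [Algebra k K] {m : ℕ}
    {Q : ∀ (F : Type) [Field F], (MvPolynomial (Fin m) k →+* F) → Prop} (h : Generically Q) :
    AlmostAll K m fun α => Q (kA k K α) (evalα k K α) := by
  obtain ⟨c, hc, h⟩ := h
  refine ⟨map (algebraMap k K) c, fun h0 => hc ?_, fun α hα => h _ _ fun h0 => hα ?_⟩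
  · exact map_injective _ (algebraMap k K).injective (h0.trans (map_zero _).symm)
  · have := congrArg (kA k K α).val h0
    rw [evalα, AlgHom.toRingHom_eq_coe, RingHom.coe_coe, ← AlgHom.comp_apply, map_zero,
      comp_aeval, aeval_def, ← eval_map] at this
    exact this

theorem toR_injective (k : Type) [Field k] (m n : ℕ) : Function.Injective (toR k m n) :=
  map_injective _ (IsFractionRing.injective _ _)

theorem isAssPrime_of_isAssociatedPrime {R : Type*} [CommRing R] [IsNoetherianRing R]
    {I ℘ : Ideal R} (h : IsAssociatedPrime ℘ (R ⧸ I)) : IsAssPrime I ℘ := by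
  obtain ⟨h℘, x, hx⟩ := isAssociatedPrime_iff.1 h
  obtain ⟨y, rfl⟩ := Ideal.Quotient.mk_surjective x
  refine ⟨h℘, y, fun z => ?_⟩
  rw [hx, Submodule.mem_colon_singleton, Submodule.mem_bot, ← Ideal.Quotient.eq_zero_iff_mem,
    mul_comm, map_mul, Algebra.smul_def]
  rfl

theorem LocElemSpec.mul_eq {k K : Type} [Field k] [Field K] [Algebra k K] {m n : ℕ}
    {α : Fin m → K} {P : Ideal (Rg k m n)} [P.IsPrime] {℘ : Ideal (Ra k K n α)} [℘.IsPrime]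
    {S : Type} [CommRing S] [Algebra (Rg k m n) S] [IsLocalization.AtPrime S P]
    {S' : Type} [CommRing S'] [Algebra (Ra k K n α) S'] [IsLocalization.AtPrime S' ℘]
    {a : S} {b : S'} (hab : LocElemSpec P ℘ a b)
    {g f : MvPolynomial (Fin n) (MvPolynomial (Fin m) k)}
    (h : a * algebraMap _ S (toR k m n g) = algebraMap _ S (toR k m n f)) :
    b * algebraMap _ S' (toRa k K n α g) = algebraMap _ S' (toRa k K n α f) := by
  obtain ⟨x, y, x', y', hy, hy', ⟨p, q, hq, hx, hx'⟩, ⟨p₁, q₁, hq₁, hy₁, hy₁'⟩, rfl, rfl⟩ := hab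
  have h1 : toR k m n f * y = toR k m n g * x := by
    apply IsLocalization.injective S P.primeCompl_le_nonZeroDivisors
    have hs : _ * algebraMap _ S y = algebraMap _ S x :=
      IsLocalization.mk'_spec S x (⟨y, hy⟩ : P.primeCompl)
    rw [map_mul, map_mul, ← h, ← hs]
    ring
  have hC : ∀ c, toR k m n (C c) = C (algebraMap _ (kU k m) c) := fun c => map_C _ _
  have hC' : ∀ c, toRa k K n α (C c) = C (evalα k K α c) := fun c => map_C _ _
  have h2 : f * C q * p₁ = g * C q₁ * p := by
    apply toR_injective
    rw [map_mul, map_mul, map_mul, map_mul, hC, hC, ← hx, ← hy₁]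
    linear_combination C (algebraMap _ (kU k m) q) * C (algebraMap _ (kU k m) q₁) * h1
  have h3 : toRa k K n α f * y' = toRa k K n α g * x' := by
    have h4 := congrArg (toRa k K n α) h2
    rw [map_mul, map_mul, map_mul, map_mul, hC', hC', ← hx', ← hy₁'] at h4
    have h5 : (C (evalα k K α q * evalα k K α q₁) : Ra k K n α) ≠ 0 :=
      C_ne_zero.2 (mul_ne_zero hq hq₁)
    apply mul_left_cancel₀ h5
    rw [C_mul]
    linear_combination h4
  have hu := IsLocalization.map_units S' (⟨y', hy'⟩ : ℘.primeCompl)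
  apply hu.mul_right_cancel
  rw [mul_right_comm, IsLocalization.mk'_spec, ← map_mul, ← map_mul, h3, mul_comm]

/-- for a finitely generated `S`-module `L`, for almost all `α`:
(i) `Ann L_α = (Ann L)_α`, i.e. the annihilator of the specialization `L_α` is the
specialization of the annihilator (the ideal generated by the specializations of a
fixed system of generators `a_1, …, a_t` of `Ann L`); and
(ii) `dim L_α = dim L`. -/
theorem specialization_annihilator_and_dimension
    (k K : Type) [Field k] [Field K] [Algebra k K] [Infinite K] {m n : ℕ}
    (P : Ideal (Rg k m n)) [P.IsPrime]
    (S : Type) [CommRing S] [Algebra (Rg k m n) S] [IsLocalization.AtPrime S P]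
    (L : Type) [AddCommGroup L] [Module S L] [Module.Finite S L]
    {rL sL : ℕ} (pL : Present S rL sL L)
    {t : ℕ} (a : Fin t → S) (ha : Ideal.span (Set.range a) = Module.annihilator S L) :
    AlmostAll K m fun α =>
      ∀ (℘ : Ideal (Ra k K n α))
        (h℘ : IsAssociatedPrime ℘ ((Ra k K n α) ⧸ idealSpec k K n α P)),
        haveI := h℘.isPrime
        ∀ (Sα : Type) [CommRing Sα] [Algebra (Ra k K n α) Sα]
          [IsLocalization.AtPrime Sα ℘]
          (B : Matrix (Fin rL) (Fin sL) Sα) (b : Fin t → Sα),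
          MatSpec (LocElemSpec P ℘) pL.A B →
          (∀ i, LocElemSpec P ℘ (a i) (b i)) →
          Module.annihilator Sα (MatCoker B) = Ideal.span (Set.range b) ∧
          moduleDim Sα (MatCoker B) = moduleDim S L := by
  let T := MvPolynomial (Fin n) (MvPolynomial (Fin m) k)
  let _ : Algebra T (Rg k m n) := (toR k m n).toAlgebra
  let _ : Algebra T S := ((algebraMap _ S).comp (toR k m n)).toAlgebra
  have : IsScalarTower T (Rg k m n) S := IsScalarTower.of_algebraMap_eq' rfl
  let M : Submonoid T := (nonZeroDivisors (MvPolynomial (Fin m) k)).map C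
  have : IsLocalization M (Rg k m n) := by
    convert MvPolynomial.isLocalization (σ := Fin n)
      (nonZeroDivisors (MvPolynomial (Fin m) k)) (kU k m)
    refine Algebra.algebra_ext _ _ fun r => ?_
    rw [MvPolynomial.algebraMap_def]
    rfl
  let P₀ : Ideal T := P.comap (toR k m n)
  have hP₀ : ∀ c, C c ∈ P₀ → c = 0 := fun c hc => by
    by_contra hc0
    have h0 : algebraMap (MvPolynomial (Fin m) k) (kU k m) c ≠ 0 :=
      IsFractionRing.to_map_eq_zero_iff.not.2 hc0
    refine Ideal.IsPrime.ne_top ‹_› (P.eq_top_of_isUnit_mem hc ?_)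
    rw [toR, map_C]
    exact h0.isUnit.map C
  have hloc : IsLocalization.AtPrime S P₀ :=
    IsLocalization.isLocalization_isLocalization_atPrime_isLocalization M S P
  obtain ⟨g₀, hg₀⟩ := IsLocalization.exist_integer_multiples_of_finite P₀.primeCompl
    fun p : Fin rL × Fin sL => pL.A p.1 p.2
  choose f hf using hg₀
  have hN : ∀ i j, pL.A i j * algebraMap T S g₀ = algebraMap T S (f (i, j)) := fun i j => by
    rw [hf, Algebra.smul_def, mul_comm]
  have hgh : ∀ i, ∃ g ∉ P₀, ∃ h, a i * algebraMap T S g = algebraMap T S h := fun i => by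
    obtain ⟨⟨h, g⟩, hgh⟩ := IsLocalization.surj P₀.primeCompl (a i)
    exact ⟨g, g.2, h, hgh⟩
  choose g hg h hgh using hgh
  have hann := pL.annihilator_eq
  have key := generically_annihilator_and_moduleDim hP₀ (N := pL.A) (g₀ := g₀) g₀.2
    (f := fun i j => f (i, j)) hN (ha.trans hann) hg hgh
  obtain ⟨c, hc, key⟩ := key.almostAll (K := K)
  refine ⟨c, hc, fun α hα ℘ h℘ => ?_⟩
  have := h℘.isPrime
  intro Sα _ _ _ B b hB hb
  have hdim : moduleDim S L = moduleDim S (MatCoker pL.A) := by rw [moduleDim, moduleDim, hann]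
  rw [hdim]
  refine key α hα ℘ (isAssPrime_of_isAssociatedPrime h℘) Sα B b
    (fun i j => (hB i j).mul_eq (hN i j)) fun i => (hb i).mul_eq (hgh i)

end Spl
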